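/- arXiv:1902.03267 — 4 statements merged into one kernel-verified Lean document; each statement's English description precedes it below -/
import Mathlib

section
/- Let X be a paracompact Hausdorff space and n < ω. Then X has covering dimension dim(X) ≤ n if and only if for every Hausdorff topological space Y, every lower locally constant set-valued mapping Φ : X ⇝ Y such that Φ(x) ↪_k Φ(x) for every x ∈ X and every k < n has a continuous selection. -/
/-- `EmbedIn k S B` means `S ↪_k B`: every continuous map from the unit `k`-sphere of
`ℝ^{k+1}` into `S` extends to a continuous map from the closed unit `(k+1)`-ball into `B`. -/
def EmbedIn {Y : Type*} [TopologicalSpace Y] (k : ℕ) (S B : Set Y) : Prop :=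
  ∀ f : (Metric.sphere (0 : EuclideanSpace ℝ (Fin (k + 1))) 1) → Y,
    Continuous f → Set.range f ⊆ S →
      ∃ g : (Metric.closedBall (0 : EuclideanSpace ℝ (Fin (k + 1))) 1) → Y,
        Continuous g ∧ Set.range g ⊆ B ∧
          ∀ z, g (Set.inclusion Metric.sphere_subset_closedBall z) = f z

/-- A set-valued mapping `Φ : X ⇝ Y` is lower locally constant if
`{x | K ⊆ Φ x}` is open for every compact `K ⊆ Y`. -/
def LowerLocallyConstant {X Y : Type*} [TopologicalSpace X] [TopologicalSpace Y]
    (Φ : X → Set Y) : Prop :=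
  ∀ K : Set Y, IsCompact K → IsOpen {x | K ⊆ Φ x}

/-- `X` has covering dimension at most `n`: every open cover of `X` admits an open
refinement covering `X` in which every point belongs to at most `n + 1` members. -/
def CovDimLE (X : Type*) [TopologicalSpace X] (n : ℕ) : Prop :=
  ∀ U : Set (Set X), (∀ u ∈ U, IsOpen u) → ⋃₀ U = Set.univ →
    ∃ V : Set (Set X),
      (∀ v ∈ V, IsOpen v) ∧
      (∀ v ∈ V, ∃ u ∈ U, v ⊆ u) ∧
      ⋃₀ V = Set.univ ∧
      ∀ x : X, {v ∈ V | x ∈ v}.Finite ∧ {v ∈ V | x ∈ v}.ncard ≤ n + 1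

open Set Topology

/-! ### The simplices spanned by finite sets of coordinates -/

/-- The simplex of `ι → ℝ` spanned by the basis vectors with indices in `σ`. -/
def coordSimplex {ι : Type*} (σ : Finset ι) : Set (ι → ℝ) :=
  {t | (∀ i, 0 ≤ t i) ∧ (∀ i ∉ σ, t i = 0) ∧ ∑ i ∈ σ, t i = 1}

theorem isClosed_coordSimplex {ι : Type*} (σ : Finset ι) : IsClosed (coordSimplex σ) := by
  have : coordSimplex σ = (⋂ i, {t : ι → ℝ | 0 ≤ t i}) ∩ (⋂ i, ⋂ (_ : i ∉ σ), {t : ι → ℝ | t i = 0})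
      ∩ {t | ∑ i ∈ σ, t i = 1} := by
    ext t
    simp [coordSimplex, and_assoc]
  rw [this]
  refine ((isClosed_iInter fun i => ?_).inter
    (isClosed_iInter fun i => isClosed_iInter fun _ => ?_)).inter ?_
  · exact isClosed_le (by fun_prop) (by fun_prop)
  · exact isClosed_eq (by fun_prop) (by fun_prop)
  · exact isClosed_eq (by fun_prop) (by fun_prop)

theorem le_one_of_mem_coordSimplex {ι : Type*} {σ : Finset ι} {t : ι → ℝ}
    (ht : t ∈ coordSimplex σ) (i : ι) : t i ≤ 1 := by
  by_cases hi : i ∈ σ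
  · rw [← ht.2.2]
    exact Finset.single_le_sum (fun j _ => ht.1 j) hi
  · rw [ht.2.1 i hi]
    exact zero_le_one

theorem isCompact_coordSimplex {ι : Type*} (σ : Finset ι) : IsCompact (coordSimplex σ) :=
  (isCompact_univ_pi fun _ : ι => isCompact_Icc (a := (0 : ℝ)) (b := 1)).of_isClosed_subset
    (isClosed_coordSimplex σ) fun _ ht i _ => ⟨ht.1 i, le_one_of_mem_coordSimplex ht i⟩

theorem mem_coordSimplex_of_support_subset {ι : Type*} {σ τ : Finset ι} {t : ι → ℝ}
    (ht : t ∈ coordSimplex σ) (h : ∀ i, t i ≠ 0 → i ∈ τ) : t ∈ coordSimplex τ := by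
  classical
  refine ⟨ht.1, fun i hi => not_not.1 fun h0 => hi (h i h0), ?_⟩
  have key : ∀ ρ : Finset ι, (∀ i, t i ≠ 0 → i ∈ ρ) → ρ ⊆ σ ∪ τ →
      ∑ i ∈ ρ, t i = ∑ i ∈ σ ∪ τ, t i := fun ρ hρ hs =>
    Finset.sum_subset hs fun i _ hi => not_not.1 fun h0 => hi (hρ i h0)
  rw [key τ h Finset.subset_union_right, ← ht.2.2,
    key σ (fun i h0 => not_not.1 fun hi => h0 (ht.2.1 i hi)) Finset.subset_union_left]

theorem mem_of_mem_coordSimplex {ι : Type*} {σ : Finset ι} {t : ι → ℝ}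
    (ht : t ∈ coordSimplex σ) {i : ι} (hi : t i ≠ 0) : i ∈ σ :=
  not_not.1 fun h => hi (ht.2.1 i h)

/-- A continuous map on the boundary of a `(k + 1)`-simplex extends to the simplex, within any
set `S` with `S ↪_k S`. -/
theorem exists_extension_coordSimplex {ι Y : Type*} [TopologicalSpace Y] {S : Set Y} {k : ℕ}
    (hS : EmbedIn k S S) {σ : Finset ι} (hσ : σ.card = k + 2) (G : (ι → ℝ) → Y)
    (hG : ∀ ρ, ρ ⊂ σ → ContinuousOn G (coordSimplex ρ) ∧ MapsTo G (coordSimplex ρ) S) :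
    ∃ H : (ι → ℝ) → Y, ContinuousOn H (coordSimplex σ) ∧ MapsTo H (coordSimplex σ) S ∧
      ∀ ρ, ρ ⊂ σ → EqOn H G (coordSimplex ρ) := by
  classical
  let E := EuclideanSpace ℝ (Fin (k + 1))
  obtain ⟨b⟩ : Nonempty (AffineBasis σ ℝ E) :=
    AffineBasis.exists_affineBasis_of_finiteDimensional (by simp [E, hσ])
  have hint := b.interior_convexHull
  have hconv := b.convexHull_eq_nonneg_coord
  have hclosed : IsClosed (convexHull ℝ (range b)) :=
    (finite_range b).isClosed_convexHull ℝ
  obtain ⟨h, -, hcl, hfr⟩ := exists_homeomorph_image_interior_closure_frontier_eq_unitBall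
    (convex_convexHull ℝ (range b))
    (interior_convexHull_nonempty_iff_affineSpan_eq_top.2 b.tot)
    (isBounded_convexHull.2 (finite_range b).isBounded)
  rw [hclosed.closure_eq] at hcl
  rw [hclosed.frontier_eq, hint, hconv] at hfr
  rw [hconv] at hcl
  -- barycentric coordinates
  let j : E → ι → ℝ := fun x i => if hi : i ∈ σ then b.coord ⟨i, hi⟩ x else 0
  have hj : Continuous j := by
    refine continuous_pi fun i => ?_
    by_cases hi : i ∈ σ
    · simpa [j, hi] using continuous_barycentric_coord b ⟨i, hi⟩
    · simpa [j, hi] using continuous_const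
  let q : (ι → ℝ) → E := fun t => ∑ i : σ, t i • b i
  have hq : Continuous q := by fun_prop
  have hqc : ∀ t ∈ coordSimplex σ, ∀ i : σ, b.coord i (q t) = t i := by
    intro t ht i
    have h1 : ∑ i : σ, t i = 1 := by rw [Finset.sum_coe_sort σ t, ht.2.2]
    have := b.coord_apply_combination_of_mem (Finset.mem_univ i) (w := fun i : σ => t i) h1
    rwa [Finset.affineCombination_eq_linear_combination _ _ _ h1] at this
  have hjq : ∀ t ∈ coordSimplex σ, j (q t) = t := by
    intro t ht
    ext i
    by_cases hi : i ∈ σ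
    · simp [j, hi, hqc t ht ⟨i, hi⟩]
    · simp [j, hi, ht.2.1 i hi]
  have hjmem : ∀ x : E, (∀ i, 0 ≤ b.coord i x) → j x ∈ coordSimplex σ := by
    intro x hx
    refine ⟨fun i => ?_, fun i hi => by simp [j, hi], ?_⟩
    · by_cases hi : i ∈ σ
      · simpa [j, hi] using hx ⟨i, hi⟩
      · simp [j, hi]
    · rw [← Finset.sum_coe_sort σ, ← b.sum_coord_apply_eq_one x]
      exact Finset.sum_congr rfl fun i _ => by simp [j]
  have hbd : ∀ z : Metric.sphere (0 : E) 1, ∃ i ∈ σ, j (h.symm z) ∈ coordSimplex (σ.erase i) := by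
    intro z
    obtain ⟨x, ⟨hx1, hx2⟩, hx3⟩ := hfr.ge z.2
    have hx4 : h.symm z = x := by rw [← hx3]; simp
    rw [hx4]
    simp only [mem_ofPred_eq, not_forall, not_lt] at hx2
    obtain ⟨i, hi⟩ := hx2
    refine ⟨i, i.2, mem_coordSimplex_of_support_subset (hjmem x hx1) fun l hl => ?_⟩
    refine Finset.mem_erase.2 ⟨?_, mem_of_mem_coordSimplex (hjmem x hx1) hl⟩
    rintro rfl
    apply hl
    simpa [j] using le_antisymm hi (hx1 i)
  have hbdc : ContinuousOn G (⋃ i : σ, coordSimplex (σ.erase i)) :=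
    (locallyFinite_of_finite _).continuousOn_iUnion (fun _ => isClosed_coordSimplex _)
      fun i => (hG _ (Finset.erase_ssubset i.2)).1
  obtain ⟨g, hgc, hgr, hgf⟩ := hS (fun z => G (j (h.symm z)))
    (hbdc.comp_continuous (by fun_prop) fun z => by
      obtain ⟨i, hi, hz⟩ := hbd z
      exact mem_iUnion.2 ⟨⟨i, hi⟩, hz⟩)
    (by
      rintro _ ⟨z, rfl⟩
      obtain ⟨i, hi, hz⟩ := hbd z
      exact (hG _ (Finset.erase_ssubset hi)).2 hz)
  have hball : ∀ t ∈ coordSimplex σ, h (q t) ∈ Metric.closedBall (0 : E) 1 := by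
    intro t ht
    rw [← hcl]
    exact mem_image_of_mem _ fun i => by rw [hqc t ht]; exact ht.1 i
  let y0 : Y := g ⟨0, by simp⟩
  refine ⟨fun t => if ht : h (q t) ∈ Metric.closedBall (0 : E) 1 then g ⟨h (q t), ht⟩ else y0,
    ?_, ?_, ?_⟩
  · rw [continuousOn_iff_continuous_domRestrict]
    have : Continuous fun t : coordSimplex σ => g ⟨h (q t), hball t t.2⟩ := by fun_prop
    refine this.congr fun t => ?_
    simp [hball t t.2, -Metric.mem_closedBall]
  · intro t ht
    simp only [hball t ht, dif_pos]
    exact hgr (mem_range_self _)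
  · intro ρ hρ t ht
    have htσ : t ∈ coordSimplex σ :=
      mem_coordSimplex_of_support_subset ht fun i hi => hρ.1 (mem_of_mem_coordSimplex ht hi)
    simp only [hball t htσ, dif_pos]
    have hs : h (q t) ∈ Metric.sphere (0 : E) 1 := by
      rw [← hfr]
      refine mem_image_of_mem _ ⟨fun i => by rw [hqc t htσ]; exact ht.1 i, fun hpos => ?_⟩
      obtain ⟨i, hi, hiρ⟩ := Finset.exists_of_ssubset hρ
      have := hpos ⟨i, hi⟩
      rw [hqc t htσ] at this
      simp only [ht.2.1 i hiρ, lt_irrefl] at this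
    have := hgf ⟨_, hs⟩
    simp only [Homeomorph.symm_apply_apply, hjq t htσ] at this
    exact this

/-- The linear map `(κ → ℝ) → (ι → ℝ)` induced by a map `r` of vertices. -/
noncomputable def pushCoord {κ ι : Type*} (r : κ → ι) (t : κ → ℝ) : ι → ℝ :=
  fun i => ∑ᶠ j, (r ⁻¹' {i}).indicator t j

theorem pushCoord_apply {κ ι : Type*} (r : κ → ι) {τ : Finset κ} {t : κ → ℝ}
    (ht : t ∈ coordSimplex τ) (i : ι) :
    pushCoord r t i = ∑ j ∈ τ, (r ⁻¹' {i}).indicator t j := by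
  refine finsum_eq_sum_of_support_subset _ fun j hj => ?_
  refine mem_of_mem_coordSimplex ht fun h0 => hj ?_
  simp [indicator, h0]

theorem continuousOn_pushCoord {κ ι : Type*} (r : κ → ι) (τ : Finset κ) :
    ContinuousOn (pushCoord r) (coordSimplex τ) := by
  classical
  refine continuousOn_pi.2 fun i => ?_
  have : ContinuousOn (fun t : κ → ℝ => ∑ j ∈ τ, (r ⁻¹' {i}).indicator t j) (coordSimplex τ) := by
    refine Continuous.continuousOn (continuous_finsetSum _ fun j _ => ?_)
    by_cases h : r j = i
    · simpa [indicator, h] using continuous_apply j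
    · simpa [indicator, h] using continuous_const
  exact this.congr fun t ht => pushCoord_apply r ht i

theorem mapsTo_pushCoord {κ ι : Type*} [DecidableEq ι] (r : κ → ι) (τ : Finset κ) :
    MapsTo (pushCoord r) (coordSimplex τ) (coordSimplex (τ.image r)) := by
  classical
  intro t ht
  refine ⟨fun i => ?_, fun i hi => ?_, ?_⟩
  · rw [pushCoord_apply r ht]
    exact Finset.sum_nonneg fun j _ => indicator_nonneg (fun l _ => ht.1 l) j
  · rw [pushCoord_apply r ht]
    refine Finset.sum_eq_zero fun j hj => indicator_of_notMem (fun h => hi ?_) _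
    exact Finset.mem_image.2 ⟨j, hj, h⟩
  · rw [← ht.2.2, Finset.sum_congr rfl fun i _ => pushCoord_apply r ht i, Finset.sum_comm]
    refine Finset.sum_congr rfl fun j hj => ?_
    simp only [indicator, mem_preimage, mem_singleton_iff]
    rw [Finset.sum_ite_eq, if_pos (Finset.mem_image_of_mem r hj)]

/-! ### Selections on skeleta of nerves -/

/-- There are a locally finite open cover `V` of `X` and a map `G` on the `k`-skeleton of its nerve
that sends the simplex spanned by `σ` into `Φ x` whenever `x ∈ V i` for all `i ∈ σ`. -/
def HasSkeletalSelection {X Y : Type*} [TopologicalSpace X] [TopologicalSpace Y]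
    (Φ : X → Set Y) (k : ℕ) : Prop :=
  ∃ (V : X → Set X) (G : (X → ℝ) → Y), (∀ i, IsOpen (V i)) ∧ ⋃ i, V i = univ ∧
    LocallyFinite V ∧ ∀ (σ : Finset X) (x : X), σ.card ≤ k + 1 → (∀ i ∈ σ, x ∈ V i) →
      ContinuousOn G (coordSimplex σ) ∧ MapsTo G (coordSimplex σ) (Φ x)

theorem HasSkeletalSelection.zero {X Y : Type*} [TopologicalSpace X] [ParacompactSpace X]
    [Nonempty X] [TopologicalSpace Y] {Φ : X → Set Y} (hne : ∀ x, (Φ x).Nonempty)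
    (hΦ : LowerLocallyConstant Φ) : HasSkeletalSelection Φ 0 := by
  classical
  obtain ⟨x0⟩ := ‹Nonempty X›
  choose y hy using hne
  obtain ⟨V, hVo, hVc, hVf, hV⟩ := precise_refinement (fun x => {x' | {y x} ⊆ Φ x'})
    (fun x => hΦ _ isCompact_singleton)
    (iUnion_eq_univ_iff.2 fun x => ⟨x, singleton_subset_iff.2 (hy x)⟩)
  refine ⟨V, fun t => y (if h : ∃ i, t i ≠ 0 then h.choose else x0), hVo, hVc, hVf,
    fun σ x hσ hx => ?_⟩
  have key : ∀ t ∈ coordSimplex σ, ∃ i ∈ σ, σ = {i} ∧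
      (if h : ∃ i, t i ≠ 0 then h.choose else x0) = i := by
    intro t ht
    have hex : ∃ i, t i ≠ 0 := by
      by_contra! h
      simpa [h] using ht.2.2
    have hmem := mem_of_mem_coordSimplex ht hex.choose_spec
    refine ⟨_, hmem, ?_, dif_pos hex⟩
    exact Finset.eq_singleton_iff_unique_mem.2
      ⟨hmem, fun l hl => Finset.card_le_one.1 hσ l hl _ hmem⟩
  refine ⟨?_, fun t ht => ?_⟩
  · rcases σ.eq_empty_or_nonempty with rfl | ⟨i, hi⟩
    · intro t ht
      obtain ⟨i, hi, -⟩ := key t ht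
      simp at hi
    · refine (continuousOn_const (c := y i)).congr fun t ht => ?_
      obtain ⟨l, hl, hσl, hl'⟩ := key t ht
      rw [hσl, Finset.mem_singleton] at hi
      simp only [hl', hi]
  · obtain ⟨i, hi, -, hi'⟩ := key t ht
    simp only [hi']
    exact hV i (hx i hi) rfl

theorem HasSkeletalSelection.succ {X Y : Type*} [TopologicalSpace X] [T2Space X]
    [ParacompactSpace X] [TopologicalSpace Y] {Φ : X → Set Y} {k : ℕ}
    (hΦ : LowerLocallyConstant Φ) (hk : ∀ x, EmbedIn k (Φ x) (Φ x))
    (h : HasSkeletalSelection Φ k) : HasSkeletalSelection Φ (k + 1) := by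
  classical
  obtain ⟨V, G, hVo, hVc, hVf, hG⟩ := h
  obtain ⟨V', hV'c, hV'o, hV'⟩ := exists_iUnion_eq_closure_subset hVo hVf.point_finite hVc
  -- extend `G` over the `(k + 1)`-simplices, separately for every `Φ z`
  have hfill : ∀ (z : X) (σ : Finset X), ∃ H : (X → ℝ) → Y, σ.card ≤ k + 2 →
      (∀ i ∈ σ, z ∈ V i) → ContinuousOn H (coordSimplex σ) ∧ MapsTo H (coordSimplex σ) (Φ z) ∧
        ∀ ρ ⊆ σ, ρ.card ≤ k + 1 → EqOn H G (coordSimplex ρ) := by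
    intro z σ
    by_cases hz : ∀ i ∈ σ, z ∈ V i
    · by_cases hσ : σ.card ≤ k + 1
      · exact ⟨G, fun _ _ => ⟨(hG σ z hσ hz).1, (hG σ z hσ hz).2, fun _ _ _ _ _ => rfl⟩⟩
      by_cases hσ2 : σ.card = k + 2
      · obtain ⟨H, h1, h2, h3⟩ := exists_extension_coordSimplex (hk z) hσ2 G fun ρ hρ =>
          hG ρ z (by have := Finset.card_lt_card hρ; omega) fun i hi => hz i (hρ.1 hi)
        refine ⟨H, fun _ _ => ⟨h1, h2, fun ρ hρ hc => h3 ρ (hρ.ssubset_of_ne ?_)⟩⟩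
        rintro rfl
        omega
      · exact ⟨G, fun h => by omega⟩
    · exact ⟨G, fun _ h => absurd h hz⟩
  choose H hH using hfill
  let O : X → Set X := fun z => (⋃ i : {i // z ∉ closure (V' i)}, closure (V' i))ᶜ ∩
    ⋂ σ ∈ (hVf.point_finite z).toFinset.powerset.filter fun σ => σ.card ≤ k + 2,
      {x | H z σ '' coordSimplex σ ⊆ Φ x}
  have hV'f : LocallyFinite fun i => closure (V' i) := hVf.subset hV'
  have hOo : ∀ z, IsOpen (O z) := by
    intro z
    refine IsOpen.inter ?_ (isOpen_biInter_finset fun σ hσ => ?_)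
    · exact ((hV'f.comp_injective Subtype.val_injective).isClosed_iUnion
        fun _ => isClosed_closure).isOpen_compl
    · simp only [Finset.mem_filter, Finset.mem_powerset] at hσ
      refine hΦ _ ((isCompact_coordSimplex σ).image_of_continuousOn (hH z σ hσ.2 fun i hi => ?_).1)
      simpa using hσ.1 hi
  have hOz : ∀ z, z ∈ O z := by
    intro z
    refine ⟨?_, mem_iInter₂.2 fun σ hσ => ?_⟩
    · simp only [mem_compl_iff, mem_iUnion, not_exists]
      exact fun i => i.2
    · simp only [Finset.mem_filter, Finset.mem_powerset] at hσ
      refine image_subset_iff.2 (hH z σ hσ.2 fun i hi => ?_).2.1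
      simpa using hσ.1 hi
  choose r hr using iUnion_eq_univ_iff.1 hV'c
  obtain ⟨W, hWo, hWc, hWf, hW⟩ := precise_refinement (fun z => O z ∩ V' (r z))
    (fun z => (hOo z).inter (hV'o _)) (iUnion_eq_univ_iff.2 fun z => ⟨z, hOz z, hr z⟩)
  have hchoice : ∀ τ : Finset X, ∃ z : τ.Nonempty → X, ∀ h, z h ∈ τ := fun τ =>
    ⟨fun h => h.choose, fun h => h.choose_spec⟩
  have hsupp : ∀ t : X → ℝ, ∃ s : Finset X, (Function.support t).Finite → ∀ i, i ∈ s ↔ t i ≠ 0 := by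
    intro t
    by_cases h : (Function.support t).Finite
    · exact ⟨h.toFinset, fun _ i => by simp⟩
    · exact ⟨∅, fun h' => absurd h' h⟩
  choose S hS using hsupp
  choose z hz using hchoice
  let G' : (X → ℝ) → Y := fun t =>
    if h : (S t).card ≤ k + 1 then G (pushCoord r t)
    else H (z (S t) (Finset.card_pos.1 (by omega))) ((S t).image r) (pushCoord r t)
  have hS' : ∀ τ : Finset X, ∀ t ∈ coordSimplex τ, ∀ i, i ∈ S t ↔ t i ≠ 0 := fun τ t ht =>
    hS t (τ.finite_toSet.subset fun i hi => mem_of_mem_coordSimplex ht hi)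
  refine ⟨W, G', hWo, hWc, hWf, fun τ x hτ hx => ?_⟩
  have hSsub : ∀ t ∈ coordSimplex τ, S t ⊆ τ := fun t ht i hi =>
    mem_of_mem_coordSimplex ht ((hS' τ t ht i).1 hi)
  by_cases hc : τ.card ≤ k + 1
  · have hGτ := hG (τ.image r) x (Finset.card_image_le.trans hc) fun i hi => by
      obtain ⟨j, hj, rfl⟩ := Finset.mem_image.1 hi
      exact hV' _ (subset_closure (hW j (hx j hj)).2)
    have heq : EqOn G' (G ∘ pushCoord r) (coordSimplex τ) := fun t ht =>
      dif_pos ((Finset.card_le_card (hSsub t ht)).trans hc)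
    refine ⟨(hGτ.1.comp (continuousOn_pushCoord r τ) (mapsTo_pushCoord r τ)).congr heq,
      MapsTo.congr (hGτ.2.comp (mapsTo_pushCoord r τ)) heq.symm⟩
  · have hne : τ.Nonempty := Finset.card_pos.1 (by omega)
    have hzO := (hW _ (hx _ (hz τ hne))).1
    have hzV : ∀ i ∈ τ.image r, z τ hne ∈ V i := by
      intro i hi
      obtain ⟨j, hj, rfl⟩ := Finset.mem_image.1 hi
      refine hV' _ (not_not.1 fun hnot => hzO.1 ?_)
      exact mem_iUnion.2 ⟨⟨_, hnot⟩, subset_closure (hW j (hx j hj)).2⟩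
    have hcard : (τ.image r).card ≤ k + 2 := Finset.card_image_le.trans hτ
    obtain ⟨h1, -, h3⟩ := hH (z τ hne) (τ.image r) hcard hzV
    have h2 : MapsTo (H (z τ hne) (τ.image r)) (coordSimplex (τ.image r)) (Φ x) := by
      refine image_subset_iff.1 (mem_iInter₂.1 hzO.2 (τ.image r) ?_)
      refine Finset.mem_filter.2 ⟨Finset.mem_powerset.2 fun i hi => ?_, hcard⟩
      simpa using hzV i hi
    have heq : EqOn G' (H (z τ hne) (τ.image r) ∘ pushCoord r) (coordSimplex τ) := by
      intro t ht
      by_cases hcS : (S t).card ≤ k + 1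
      · have htS : t ∈ coordSimplex (S t) :=
          mem_coordSimplex_of_support_subset ht fun i hi => (hS' τ t ht i).2 hi
        refine (dif_pos hcS).trans (h3 ((S t).image r) (Finset.image_subset_image (hSsub t ht))
          (Finset.card_image_le.trans hcS) (mapsTo_pushCoord r _ htS)).symm
      · have hSτ : S t = τ := Finset.eq_of_subset_of_card_le (hSsub t ht) (by omega)
        refine (dif_neg hcS).trans ?_
        simp only [hSτ, Function.comp_apply]
    refine ⟨(h1.comp (continuousOn_pushCoord r τ) (mapsTo_pushCoord r τ)).congr heq,
      MapsTo.congr (h2.comp (mapsTo_pushCoord r τ)) heq.symm⟩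

/-! ### Partitions of unity of bounded order -/

theorem CovDimLE.exists_precise_refinement {X ι : Type*} [TopologicalSpace X] {n : ℕ}
    (h : CovDimLE X n) (U : ι → Set X) (hUo : ∀ i, IsOpen (U i)) (hU : ⋃ i, U i = univ) :
    ∃ W : ι → Set X, (∀ i, IsOpen (W i)) ∧ ⋃ i, W i = univ ∧ (∀ i, W i ⊆ U i) ∧
      ∀ x, {i | x ∈ W i}.Finite ∧ {i | x ∈ W i}.ncard ≤ n + 1 := by
  rcases isEmpty_or_nonempty X with hX | ⟨⟨x0⟩⟩
  · exact ⟨U, hUo, hU, fun _ => Subset.rfl, fun x => isEmptyElim x⟩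
  obtain ⟨i0, -⟩ := mem_iUnion.1 (hU ▸ mem_univ x0)
  obtain ⟨V, hVo, hVU, hVc, hVn⟩ := h (range U) (forall_mem_range.2 hUo) (by rwa [sUnion_range])
  have : ∀ v : Set X, ∃ i, v ∈ V → v ⊆ U i := by
    intro v
    by_cases hv : v ∈ V
    · obtain ⟨_, ⟨i, rfl⟩, hi⟩ := hVU v hv
      exact ⟨i, fun _ => hi⟩
    · exact ⟨i0, fun h => absurd h hv⟩
  choose r hr using this
  have heq : ∀ x, {i | x ∈ ⋃₀ {v ∈ V | r v = i}} = r '' {v ∈ V | x ∈ v} := by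
    intro x
    ext i
    constructor
    · rintro ⟨v, ⟨hv, rfl⟩, hx⟩
      exact ⟨v, ⟨hv, hx⟩, rfl⟩
    · rintro ⟨v, ⟨hv, hx⟩, rfl⟩
      exact ⟨v, ⟨hv, rfl⟩, hx⟩
  refine ⟨fun i => ⋃₀ {v ∈ V | r v = i}, fun i => isOpen_sUnion fun v hv => hVo v hv.1,
    ?_, fun i => sUnion_subset ?_, fun x => ?_⟩
  · refine iUnion_eq_univ_iff.2 fun x => ?_
    obtain ⟨v, hv, hx⟩ := mem_sUnion.1 (hVc ▸ mem_univ x)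
    exact ⟨r v, v, ⟨hv, rfl⟩, hx⟩
  · rintro v ⟨hv, rfl⟩
    exact hr v hv
  · rw [heq]
    exact ⟨(hVn x).1.image r, (ncard_image_le (hVn x).1).trans (hVn x).2⟩

theorem CovDimLE.exists_partition {X ι : Type*} [TopologicalSpace X] [T2Space X]
    [ParacompactSpace X] {n : ℕ} (h : CovDimLE X n) (U : ι → Set X) (hUo : ∀ i, IsOpen (U i))
    (hU : ⋃ i, U i = univ) :
    ∃ p : X → ι → ℝ, Continuous p ∧ (LocallyFinite fun i => {x | p x i ≠ 0}) ∧
      (∀ x i, p x i ≠ 0 → x ∈ U i) ∧ ∀ x, ∃ σ : Finset ι, (∀ i, i ∈ σ ↔ p x i ≠ 0) ∧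
        σ.card ≤ n + 1 ∧ p x ∈ coordSimplex σ := by
  obtain ⟨W, hWo, hWc, hWU, hWn⟩ := h.exists_precise_refinement U hUo hU
  obtain ⟨f, hf⟩ := PartitionOfUnity.exists_isSubordinate isClosed_univ W hWo hWc.ge
  have hfW : ∀ x i, f i x ≠ 0 → x ∈ W i := fun x i hi => hf i (subset_tsupport _ hi)
  refine ⟨fun x i => f i x, by fun_prop, f.locallyFinite, fun x i hi => hWU i (hfW x i hi),
    fun x => ?_⟩
  have hfin : {i | f i x ≠ 0}.Finite := (hWn x).1.subset (hfW x)
  refine ⟨hfin.toFinset, fun i => by simp, ?_, fun i => f.nonneg i x, fun i hi => by simpa using hi,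
    ?_⟩
  · rw [← ncard_eq_toFinset_card _ hfin]
    exact (ncard_le_ncard (hfW x) (hWn x).1).trans (hWn x).2
  · rw [← f.sum_eq_one (mem_univ x)]
    exact (finsum_eq_sum_of_support_subset _ (by simp [Function.support])).symm

theorem CovDimLE.exists_selection {X Y : Type*} [TopologicalSpace X] [T2Space X]
    [ParacompactSpace X] [TopologicalSpace Y] {n : ℕ} (h : CovDimLE X n) {Φ : X → Set Y}
    (hne : ∀ x, (Φ x).Nonempty) (hΦ : LowerLocallyConstant Φ)
    (hk : ∀ x, ∀ k, k < n → EmbedIn k (Φ x) (Φ x)) :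
    ∃ f : X → Y, Continuous f ∧ ∀ x, f x ∈ Φ x := by
  rcases isEmpty_or_nonempty X with hX | hX
  · exact ⟨fun x => isEmptyElim x, continuous_iff_continuousAt.2 fun x => isEmptyElim x,
      fun x => isEmptyElim x⟩
  have hsk : ∀ k ≤ n, HasSkeletalSelection Φ k := by
    intro k
    induction k with
    | zero => exact fun _ => .zero hne hΦ
    | succ k ih => exact fun hkn => (ih (by omega)).succ hΦ fun x => hk x k (by omega)
  obtain ⟨V, G, hVo, hVc, -, hG⟩ := hsk n le_rfl
  obtain ⟨p, hpc, hpf, hpV, hp⟩ := h.exists_partition V hVo hVc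
  choose σ hσ hσn hpσ using hp
  have hGx : ∀ x, ContinuousOn G (coordSimplex (σ x)) ∧ MapsTo G (coordSimplex (σ x)) (Φ x) :=
    fun x => hG (σ x) x (hσn x) fun i hi => hpV x i ((hσ x i).1 hi)
  refine ⟨fun x => G (p x), ?_, fun x => (hGx x).2 (hpσ x)⟩
  have hlf : LocallyFinite fun τ : Finset X => {x | σ x = τ} := by
    intro x
    obtain ⟨N, hN, hfin⟩ := hpf x
    refine ⟨N, hN, hfin.finite_subsets.preimage (f := fun τ : Finset X => (τ : Set X))
      Finset.coe_injective.injOn |>.subset ?_⟩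
    rintro τ ⟨x', rfl, hx'⟩ i hi
    exact ⟨x', (hσ x' i).1 hi, hx'⟩
  refine hlf.closure.continuous (iUnion_eq_univ_iff.2 fun x => ⟨σ x, subset_closure rfl⟩)
    (fun _ => isClosed_closure) fun τ => ?_
  rcases {x | σ x = τ}.eq_empty_or_nonempty with he | ⟨x, rfl⟩
  · simp [he]
  · refine (hGx x).1.comp hpc.continuousOn fun x' hx' => ?_
    refine (isClosed_coordSimplex _).closure_subset (hpc.closure_preimage_subset _ ?_)
    exact closure_mono (fun y hy => by rw [← show σ y = σ x from hy]; exact hpσ y) hx'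

/-! ### The covering dimension of compact subsets of Euclidean spaces -/

/-- The coordinates of `y - v`, together with an additional coordinate `0`. -/
def gridOffset {ι : Type*} (y : ι → ℝ) (v : ι → ℤ) (j : Option ι) : ℝ :=
  j.elim 0 fun i => y i - v i

/-- Membership in the open star of the vertex `v` of the Freudenthal triangulation determines `v`
up to the choice of a coordinate (possibly the additional one) at which `gridOffset` is minimal. -/
theorem exists_eq_floor_of_gridOffset {ι : Type*} [Finite ι] {y : ι → ℝ} {v : ι → ℤ}
    (h : ∀ j l, gridOffset y v j - gridOffset y v l < 1) :
    ∃ j : Option ι, v = fun i => ⌊y i + j.elim 0 fun l => Int.fract (-y l)⌋ := by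
  obtain ⟨j, hj⟩ := Finite.exists_min (gridOffset y v)
  have hc : (j.elim 0 fun l => Int.fract (-y l)) = -gridOffset y v j := by
    cases j with
    | none => simp [gridOffset]
    | some l =>
      have h1 := h none (some l)
      have h2 := hj none
      simp only [gridOffset, Option.elim] at h1 h2 ⊢
      exact Int.fract_eq_iff.2 ⟨by linarith, by linarith, -v l, by push_cast; ring⟩
  refine ⟨j, funext fun i => (Int.floor_eq_iff.2 ?_).symm⟩
  have h1 := hj (some i)
  have h2 := h (some i) j
  rw [hc]
  simp only [gridOffset, Option.elim] at h1 h2 ⊢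
  constructor <;> linarith

theorem IsCompact.covDimLE {d : ℕ} {B : Set (EuclideanSpace ℝ (Fin d))} (hB : IsCompact B) :
    CovDimLE B d := by
  intro U hUo hU
  have : CompactSpace B := isCompact_iff_compactSpace.1 hB
  obtain ⟨δ, hδ, hL⟩ := lebesgue_number_lemma_of_metric_sUnion isCompact_univ hUo hU.ge
  obtain ⟨ε, hε, hεδ⟩ : ∃ ε : ℝ, 0 < ε ∧ d * (2 * ε) ^ 2 < δ ^ 2 := by
    refine ⟨δ / (2 * (d + 1)), by positivity, ?_⟩
    have h1 : 2 * (δ / (2 * ((d : ℝ) + 1))) = δ / (d + 1) := by field_simp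
    rw [h1, div_pow, ← mul_div_assoc, div_lt_iff₀ (by positivity)]
    nlinarith [pow_pos hδ 2, mul_nonneg (pow_pos hδ 2).le (Nat.cast_nonneg (α := ℝ) d),
      mul_nonneg (pow_pos hδ 2).le (sq_nonneg (d : ℝ))]
  let y : B → Fin d → ℝ := fun x i => (x : EuclideanSpace ℝ (Fin d)) i / ε
  have hy : ∀ i, Continuous fun x => y x i := by
    intro i
    fun_prop
  let S : (Fin d → ℤ) → Set B := fun v =>
    {x | ∀ j l, gridOffset (y x) v j - gridOffset (y x) v l < 1}
  have hoff : ∀ v j, Continuous fun x => gridOffset (y x) v j := by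
    intro v j
    cases j with
    | none => exact continuous_const
    | some i => exact (hy i).sub continuous_const
  have hSo : ∀ v, IsOpen (S v) := by
    intro v
    have : S v = ⋂ j, ⋂ l, {x | gridOffset (y x) v j - gridOffset (y x) v l < 1} := by
      ext x
      simp [S]
    rw [this]
    exact isOpen_iInter_of_finite fun j => isOpen_iInter_of_finite fun l =>
      isOpen_lt ((hoff v j).sub (hoff v l)) continuous_const
  have hSd : ∀ v x x', x ∈ S v → x' ∈ S v → dist x' x < δ := by
    intro v x x' hx hx'
    rw [Subtype.dist_eq, EuclideanSpace.dist_eq, Real.sqrt_lt' hδ]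
    refine lt_of_le_of_lt ?_ hεδ
    have : (d : ℝ) * (2 * ε) ^ 2 = ∑ _i : Fin d, (2 * ε) ^ 2 := by simp
    rw [this]
    refine Finset.sum_le_sum fun i _ => ?_
    have h1 := hx none (some i)
    have h2 := hx (some i) none
    have h3 := hx' none (some i)
    have h4 := hx' (some i) none
    simp only [gridOffset, Option.elim] at h1 h2 h3 h4
    have h5 : |y x' i - y x i| ≤ 2 := abs_le.2 ⟨by linarith, by linarith⟩
    have h6 : y x' i - y x i = ((x' : EuclideanSpace ℝ (Fin d)) i - x.1 i) / ε := by
      simp only [y]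
      ring
    rw [h6, abs_div, abs_of_pos hε, div_le_iff₀ hε] at h5
    exact pow_le_pow_left₀ dist_nonneg h5 2
  refine ⟨{s | s.Nonempty ∧ ∃ v, s = S v}, ?_, ?_, ?_, fun x => ?_⟩
  · rintro _ ⟨-, v, rfl⟩
    exact hSo v
  · rintro _ ⟨⟨x, hx⟩, v, rfl⟩
    obtain ⟨u, hu, hxu⟩ := hL x (mem_univ x)
    exact ⟨u, hu, fun x' hx' => hxu (hSd v x x' hx hx')⟩
  · refine eq_univ_of_forall fun x => ?_
    have hx : x ∈ S fun i => ⌊y x i⌋ := by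
      have h01 : ∀ j, 0 ≤ gridOffset (y x) (fun i => ⌊y x i⌋) j ∧
          gridOffset (y x) (fun i => ⌊y x i⌋) j < 1 := by
        intro j
        cases j with
        | none => simp [gridOffset]
        | some i => exact ⟨Int.fract_nonneg (y x i), Int.fract_lt_one (y x i)⟩
      intro j l
      linarith [(h01 j).2, (h01 l).1]
    exact ⟨_, ⟨⟨x, hx⟩, _, rfl⟩, hx⟩
  · let F : Option (Fin d) → Set B := fun j =>
      S fun i => ⌊y x i + j.elim 0 fun l => Int.fract (-y x l)⌋
    have hsub : {v ∈ {s | s.Nonempty ∧ ∃ v, s = S v} | x ∈ v} ⊆ F '' univ := by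
      rintro _ ⟨⟨-, v, rfl⟩, hx⟩
      obtain ⟨j, hj⟩ := exists_eq_floor_of_gridOffset hx
      exact ⟨j, mem_univ j, by simp only [F]; rw [← hj]⟩
    have hfin : (F '' univ).Finite := finite_univ.image F
    refine ⟨hfin.subset hsub, (ncard_le_ncard hsub hfin).trans ?_⟩
    refine (ncard_image_le finite_univ).trans ?_
    simp [ncard_univ]

/-! ### Skeleta of simplices -/

theorem convex_coordSimplex {ι : Type*} (σ : Finset ι) : Convex ℝ (coordSimplex σ) := by
  intro s hs t ht a b ha hb hab
  refine ⟨fun i => ?_, fun i hi => ?_, ?_⟩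
  · exact add_nonneg (mul_nonneg ha (hs.1 i)) (mul_nonneg hb (ht.1 i))
  · simp [hs.2.1 i hi, ht.2.1 i hi]
  · simp [Finset.sum_add_distrib, ← Finset.mul_sum, hs.2.2, ht.2.2, hab]

theorem exists_ne_zero_of_mem_coordSimplex {ι : Type*} {σ : Finset ι} {t : ι → ℝ}
    (ht : t ∈ coordSimplex σ) : ∃ i, t i ≠ 0 := by
  by_contra! h
  simpa [h] using ht.2.2

/-- The `n`-skeleton of the full simplex with vertex set `ι`. -/
def coordSkeleton (ι : Type*) (n : ℕ) : Set (ι → ℝ) :=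
  {t | ∃ σ : Finset ι, σ.card ≤ n + 1 ∧ t ∈ coordSimplex σ}

/-- The `n`-skeleton of a nonempty finite-dimensional simplex is `C^{n-1}`. -/
theorem embedIn_coordSkeleton {ι : Type*} {n k : ℕ} (hk : k < n) {A : Finset ι}
    (hA : A.Nonempty) :
    EmbedIn k {t : coordSkeleton ι n | ∀ i, t.1 i ≠ 0 → i ∈ A}
      {t : coordSkeleton ι n | ∀ i, t.1 i ≠ 0 → i ∈ A} := by
  intro f hf hfA
  have hfA' : ∀ w i, (f w).1 i ≠ 0 → i ∈ A := fun w => hfA (mem_range_self w)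
  let B := Metric.closedBall (0 : EuclideanSpace ℝ (Fin (k + 1))) 1
  let e : Metric.sphere (0 : EuclideanSpace ℝ (Fin (k + 1))) 1 → B :=
    inclusion Metric.sphere_subset_closedBall
  have he : IsClosedEmbedding e :=
    (continuous_inclusion _).isClosedEmbedding (inclusion_injective _)
  -- approximate `f` on the ball, along the carriers of `f` on the sphere
  let O : ι → Set B := fun i => {z | i ∈ A ∧ z ∉ e '' {w | (f w).1 i = 0}}
  have hOo : ∀ i, IsOpen (O i) := by
    intro i
    refine IsOpen.inter isOpen_const (he.isClosedMap _ ?_).isOpen_compl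
    exact isClosed_eq ((continuous_apply i).comp (continuous_subtype_val.comp hf)) continuous_const
  have hO : ⋃ i, O i = univ := by
    refine iUnion_eq_univ_iff.2 fun z => ?_
    by_cases hz : z ∈ range e
    · obtain ⟨w, rfl⟩ := hz
      obtain ⟨σ, -, hσ⟩ := (f w).2
      obtain ⟨i, hi⟩ := exists_ne_zero_of_mem_coordSimplex hσ
      refine ⟨i, hfA' w i hi, ?_⟩
      rintro ⟨w', hw', hww⟩
      rw [he.injective hww] at hw'
      exact hi hw'
    · obtain ⟨i, hi⟩ := hA
      exact ⟨i, hi, fun h => hz (image_subset_range _ _ h)⟩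
  have hBc : IsCompact (Metric.closedBall (0 : EuclideanSpace ℝ (Fin (k + 1))) 1) :=
    isCompact_closedBall _ _
  have : CompactSpace B := isCompact_iff_compactSpace.1 hBc
  obtain ⟨q, hqc, -, hqO, hq⟩ := hBc.covDimLE.exists_partition O hOo hO
  obtain ⟨F, hF⟩ := ContinuousMap.exists_extension' he
    (⟨fun w => (f w).1, continuous_subtype_val.comp hf⟩ :
      C(Metric.sphere (0 : EuclideanSpace ℝ (Fin (k + 1))) 1, ι → ℝ))
  have hFe : ∀ w, F (e w) = (f w).1 := fun w => congrFun hF w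
  have hqf : ∀ w i, q (e w) i ≠ 0 → (f w).1 i ≠ 0 := fun w i hi h0 =>
    (hqO _ i hi).2 ⟨w, h0, rfl⟩
  -- interpolate between `q` on the inner half of the ball and `f` on the sphere
  have hm : ∀ z : B, 0 < max 1 (2 * ‖z.1‖) := fun z => lt_max_of_lt_left one_pos
  have hρn : ∀ z : B, ‖(2 / max 1 (2 * ‖z.1‖)) • z.1‖ = 2 * ‖z.1‖ / max 1 (2 * ‖z.1‖) := by
    intro z
    rw [norm_smul, norm_div, Real.norm_of_nonneg (hm z).le, Real.norm_two, div_mul_eq_mul_div]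
  let ρ : B → B := fun z => ⟨(2 / max 1 (2 * ‖z.1‖)) • z.1, by
    rw [mem_closedBall_zero_iff, hρn, div_le_one (hm z)]
    exact le_max_right _ _⟩
  have hs : Continuous fun z : B => 2 / max 1 (2 * ‖z.1‖) :=
    Continuous.div continuous_const (by fun_prop) fun z => (hm z).ne'
  have hρ : Continuous ρ := (hs.smul continuous_subtype_val).subtype_mk _
  let c : B → ℝ := fun z => max 0 (2 * ‖z.1‖ - 1)
  have hc : Continuous c := by fun_prop
  let g : B → ι → ℝ := fun z => (1 - c z) • q (ρ z) + c z • F (ρ z)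
  have hg : Continuous g := by fun_prop
  have hgA : ∀ z, ∃ h : g z ∈ coordSkeleton ι n, ∀ i, g z i ≠ 0 → i ∈ A := by
    intro z
    rcases le_or_gt (2 * ‖z.1‖) 1 with hz | hz
    · have hcz : c z = 0 := max_eq_left (by linarith)
      have hgz : g z = q (ρ z) := by simp [g, hcz]
      obtain ⟨σ, -, hσ, hqσ⟩ := hq (ρ z)
      rw [hgz]
      exact ⟨⟨σ, by omega, hqσ⟩, fun i hi => (hqO _ i hi).1⟩
    · have hz1 : ‖z.1‖ ≤ 1 := mem_closedBall_zero_iff.1 z.2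
      have hcz : c z = 2 * ‖z.1‖ - 1 := max_eq_right (by linarith)
      have hw : ((ρ z : B) : EuclideanSpace ℝ (Fin (k + 1))) ∈ Metric.sphere 0 1 := by
        rw [mem_sphere_zero_iff_norm]
        simp only [ρ]
        rw [hρn, max_eq_right hz.le, div_self (by linarith)]
      obtain ⟨w, hw⟩ : ∃ w, e w = ρ z := ⟨⟨_, hw⟩, rfl⟩
      obtain ⟨σ, hσ, hfσ⟩ := (f w).2
      obtain ⟨τ, -, -, hqτ⟩ := hq (e w)
      have hqσ : q (e w) ∈ coordSimplex σ := mem_coordSimplex_of_support_subset hqτ fun i hi =>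
        mem_of_mem_coordSimplex hfσ (hqf w i hi)
      have hgz : g z = (1 - c z) • q (e w) + c z • (f w).1 := by simp only [g, ← hw, hFe]
      refine ⟨⟨σ, hσ, ?_⟩, fun i hi => hfA' w i fun h0 => hi ?_⟩
      · rw [hgz]
        exact convex_coordSimplex σ hqσ hfσ (by linarith) (by linarith) (by ring)
      · have hq0 : q (e w) i = 0 := not_not.1 fun h => hqf w i h h0
        simp [hgz, h0, hq0]
  refine ⟨fun z => ⟨g z, (hgA z).1⟩, hg.subtype_mk _, ?_, fun w => Subtype.ext ?_⟩
  · rintro _ ⟨z, rfl⟩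
    exact (hgA z).2
  · have hw : ‖w.1‖ = 1 := mem_sphere_zero_iff_norm.1 w.2
    have hcw : c (e w) = 1 := by
      simp only [c, e, inclusion, hw]
      norm_num
    have hρw : ρ (e w) = e w := by
      apply Subtype.ext
      simp only [ρ, e, hw]
      norm_num
    change g (e w) = (f w).1
    simp only [g, hcw, hρw, hFe]
    simp

/-! ### Refinements from selections -/

/-- A partition of unity yields an open cover by sets `W σ`, on which the functions with indices in
`σ` do not vanish, such that `W σ` and `W τ` are disjoint when `σ ≠ τ` have the same cardinality. -/
theorem PartitionOfUnity.exists_cover_finset {ι X : Type*} [TopologicalSpace X]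
    (p : PartitionOfUnity ι X) :
    ∃ W : Finset ι → Set X, (∀ σ, IsOpen (W σ)) ∧ (∀ σ, ∀ i ∈ σ, ∀ x ∈ W σ, p i x ≠ 0) ∧
      (∀ x, ∃ σ : Finset ι, σ.Nonempty ∧ x ∈ W σ) ∧
      ∀ σ τ : Finset ι, ∀ x, σ.card = τ.card → x ∈ W σ → x ∈ W τ → σ = τ := by
  classical
  refine ⟨fun σ => {x | ∀ i ∈ σ, 0 < p i x ∧ ∀ j ∉ σ, p j x < p i x}, fun σ => ?_,
    fun σ i hi x hx => (hx i hi).1.ne', fun x => ?_, fun σ τ x hc hσ hτ => ?_⟩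
  · refine isOpen_iff_mem_nhds.2 fun x hx => ?_
    obtain ⟨N, hN, hfin⟩ := p.locallyFinite x
    have h1 : ∀ᶠ y in 𝓝 x, ∀ i ∈ σ, 0 < p i y :=
      (Finset.eventually_all σ).2 fun i hi =>
        (p i).continuous.continuousAt.eventually (lt_mem_nhds (hx i hi).1)
    have h2 : ∀ᶠ y in 𝓝 x, ∀ i ∈ σ, ∀ j ∈ hfin.toFinset \ σ, p j y < p i y :=
      (Finset.eventually_all σ).2 fun i hi => (Finset.eventually_all _).2 fun j hj =>
        (p j).continuous.continuousAt.eventually_lt (p i).continuous.continuousAt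
          ((hx i hi).2 j (Finset.mem_sdiff.1 hj).2)
    filter_upwards [hN, h1, h2] with y hy h1 h2 i hi
    refine ⟨h1 i hi, fun j hj => ?_⟩
    by_cases h0 : p j y = 0
    · rw [h0]
      exact h1 i hi
    · refine h2 i hi j (Finset.mem_sdiff.2 ⟨?_, hj⟩)
      exact hfin.mem_toFinset.2 ⟨y, h0, hy⟩
  · refine ⟨(p.locallyFinite.point_finite x).toFinset, ?_, fun i hi => ⟨?_, fun j hj => ?_⟩⟩
    · by_contra hne
      have h0 : ∀ i, p i x = 0 := fun i => not_not.1 fun h =>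
        hne ⟨i, (Finite.mem_toFinset _).2 h⟩
      simpa [h0] using p.sum_eq_one (mem_univ x)
    · exact lt_of_le_of_ne (p.nonneg i x) (Ne.symm ((Finite.mem_toFinset _).1 hi))
    · have h0 : p j x = 0 := not_not.1 fun h => hj ((Finite.mem_toFinset _).2 h)
      rw [h0]
      exact lt_of_le_of_ne (p.nonneg i x) (Ne.symm ((Finite.mem_toFinset _).1 hi))
  · by_contra hne
    obtain ⟨i, hi, hi'⟩ := Finset.not_subset.1 fun h =>
      hne (Finset.eq_of_subset_of_card_le h hc.ge)
    obtain ⟨j, hj, hj'⟩ := Finset.not_subset.1 fun h =>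
      hne (Finset.eq_of_subset_of_card_le h hc.le).symm
    exact lt_asymm ((hσ i hi).2 j hj') ((hτ j hj).2 i hi')

theorem covDimLE_of_selection {X : Type*} [TopologicalSpace X] [T2Space X] [ParacompactSpace X]
    {n : ℕ} (hsel : ∀ (Y : Type) [TopologicalSpace Y] [T2Space Y] (Φ : X → Set Y),
      (∀ x, (Φ x).Nonempty) → LowerLocallyConstant Φ →
      (∀ x, ∀ k, k < n → EmbedIn k (Φ x) (Φ x)) →
      ∃ f : X → Y, Continuous f ∧ ∀ x, f x ∈ Φ x) : CovDimLE X n := by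
  classical
  intro U hUo hU
  obtain ⟨p, hp⟩ := PartitionOfUnity.exists_isSubordinate isClosed_univ
    (fun u : U => (u : Set X)) (fun u => hUo u u.2) (by rw [← sUnion_eq_iUnion, hU])
  obtain ⟨W, hWo, hWp, hWc, hWd⟩ := p.exists_cover_finset
  let M : ℕ → Set X := fun m => ⋃ σ : {σ : Finset U // σ.card = m + 1}, W σ
  have hMo : ∀ m, IsOpen (M m) := fun m => isOpen_iUnion fun σ => hWo _
  have hMfin : ∀ x, {m | x ∈ M m}.Finite := by
    intro x
    refine (finite_Iio (p.locallyFinite.point_finite x).toFinset.card).subset fun m hm => ?_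
    obtain ⟨⟨σ, hσ⟩, hx⟩ := mem_iUnion.1 hm
    refine Nat.lt_of_succ_le (hσ.symm.le.trans (Finset.card_le_card fun i hi => ?_))
    exact (Finite.mem_toFinset _).2 (hWp σ i hi x hx)
  have hMne : ∀ x, ∃ m, x ∈ M m := by
    intro x
    obtain ⟨σ, hne, hx⟩ := hWc x
    exact ⟨σ.card - 1, mem_iUnion.2 ⟨⟨σ, by have := hne.card_pos; omega⟩, hx⟩⟩
  obtain ⟨f, hf, hfM⟩ := hsel (coordSkeleton ℕ n) (fun x => {t | ∀ m, t.1 m ≠ 0 → x ∈ M m})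
    (by
      intro x
      obtain ⟨m, hm⟩ := hMne x
      refine ⟨⟨Pi.single m 1, {m}, by simp, fun i => ?_, fun i hi => ?_, by simp⟩, fun i hi => ?_⟩
      · by_cases h : i = m <;> simp [h]
      · simp only [Finset.mem_singleton] at hi
        simp [hi]
      · by_cases h : i = m
        · rwa [h]
        · simp [h] at hi)
    (by
      intro K _
      have hK : {x | K ⊆ {t : coordSkeleton ℕ n | ∀ m, t.1 m ≠ 0 → x ∈ M m}} =
          ⋂ m ∈ {m | ∃ t ∈ K, t.1 m ≠ 0}, M m := by
        ext x
        simp only [mem_ofPred_eq, mem_iInter]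
        exact ⟨fun h m ⟨t, ht, hm⟩ => h ht m hm, fun h t ht m hm => h m ⟨t, ht, hm⟩⟩
      rw [hK]
      by_cases hfin : {m | ∃ t ∈ K, t.1 m ≠ 0}.Finite
      · exact hfin.isOpen_biInter fun m _ => hMo m
      · convert isOpen_empty
        refine eq_empty_of_forall_notMem fun x hx => hfin ((hMfin x).subset fun m hm => ?_)
        exact mem_iInter₂.1 hx m hm)
    (by
      intro x k hk
      have := embedIn_coordSkeleton hk (A := (hMfin x).toFinset)
        ((Finite.toFinset_nonempty _).2 (hMne x))
      simpa using this)
  refine ⟨{v | ∃ (m : ℕ) (σ : Finset U), σ.card = m + 1 ∧ v = {x | (f x).1 m ≠ 0} ∩ W σ},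
    ?_, ?_, ?_, fun x => ?_⟩
  · rintro _ ⟨m, σ, -, rfl⟩
    refine IsOpen.inter ?_ (hWo σ)
    exact isOpen_ne_fun ((continuous_apply m).comp (continuous_subtype_val.comp hf))
      continuous_const
  · rintro _ ⟨m, σ, hσ, rfl⟩
    obtain ⟨i, hi⟩ := Finset.card_pos.1 (by omega : 0 < σ.card)
    exact ⟨i, i.2, fun x hx => hp i (subset_tsupport _ (hWp σ i hi x hx.2))⟩
  · refine eq_univ_of_forall fun x => ?_
    obtain ⟨σ, -, hσ⟩ := (f x).2
    obtain ⟨m, hm⟩ := exists_ne_zero_of_mem_coordSimplex hσ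
    obtain ⟨⟨τ, hτ⟩, hx⟩ := mem_iUnion.1 (hfM x m hm)
    exact ⟨_, ⟨m, τ, hτ, rfl⟩, hm, hx⟩
  · obtain ⟨τ, hτn, hτ⟩ := (f x).2
    have : ∀ m, ∃ σ : Finset U, x ∈ M m → σ.card = m + 1 ∧ x ∈ W σ := by
      intro m
      by_cases hm : x ∈ M m
      · obtain ⟨⟨σ, hσ⟩, hx⟩ := mem_iUnion.1 hm
        exact ⟨σ, fun _ => ⟨hσ, hx⟩⟩
      · exact ⟨∅, fun h => absurd h hm⟩
    choose c hc using this
    let F : ℕ → Set X := fun m => {y | (f y).1 m ≠ 0} ∩ W (c m)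
    have hsub : {v ∈ {v | ∃ (m : ℕ) (σ : Finset U), σ.card = m + 1 ∧
        v = {x | (f x).1 m ≠ 0} ∩ W σ} | x ∈ v} ⊆ F '' τ := by
      rintro _ ⟨⟨m, σ, hσ, rfl⟩, hm, hx⟩
      obtain ⟨h1, h2⟩ := hc m (hfM x m hm)
      refine ⟨m, mem_of_mem_coordSimplex hτ hm, ?_⟩
      simp only [F]
      rw [hWd (c m) σ x (h1.trans hσ.symm) h2 hx]
    have hfin : (F '' τ).Finite := τ.finite_toSet.image F
    refine ⟨hfin.subset hsub, (ncard_le_ncard hsub hfin).trans ?_⟩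
    refine (ncard_image_le τ.finite_toSet).trans ?_
    rwa [ncard_coe_finset]

/-- A paracompact Hausdorff space has covering dimension at most `n` iff every lower
locally constant mapping into any Hausdorff space whose values `Φ x` satisfy
`Φ x ↪_k Φ x` for all `k < n` has a continuous selection. -/
theorem covDimLE_iff_selection
    {X : Type*} [TopologicalSpace X] [T2Space X] [ParacompactSpace X] (n : ℕ) :
    CovDimLE X n ↔
      ∀ (Y : Type) [TopologicalSpace Y] [T2Space Y] (Φ : X → Set Y),
        (∀ x, (Φ x).Nonempty) →
        LowerLocallyConstant Φ →
        (∀ x, ∀ k, k < n → EmbedIn k (Φ x) (Φ x)) →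
        ∃ f : X → Y, Continuous f ∧ ∀ x, f x ∈ Φ x :=
  ⟨fun h _ _ _ _ hne hΦ hk => h.exists_selection hne hΦ hk, covDimLE_of_selection⟩
end

section
/- Let 𝒰_0, …, 𝒰_n be point-finite open covers of a topological space X (each point of X belongs to only finitely many members of each 𝒰_k). Then for every p ∈ X there exists an open neighbourhood V of p such that for every q ∈ V one has Δ_{[𝒰_{≤n}]}(p) ⊆ Δ_{[𝒰_{≤n}]}(q); that is, every Δ-simplex σ with p ∈ ker[σ] also satisfies q ∈ ker[σ]. -/
/-- `σ` is a Δ-simplex over the families `𝒰 0, …, 𝒰 n`: a nonempty finite set of pairs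
`(U, k)` with `k ≤ n` and `U ∈ 𝒰 k`, containing at most one pair with second coordinate
`k` for each `k`, and with nonempty kernel `⋂ {U : (U, k) ∈ σ}`. -/
def IsDeltaSimplex {X : Type*} (𝒰 : ℕ → Set (Set X)) (n : ℕ) (σ : Set (Set X × ℕ)) : Prop :=
  σ.Finite ∧ σ.Nonempty ∧
  (∀ s ∈ σ, s.2 ≤ n ∧ s.1 ∈ 𝒰 s.2) ∧
  (∀ s ∈ σ, ∀ t ∈ σ, s.2 = t.2 → s = t) ∧
  (⋂ s ∈ σ, s.1).Nonempty

/-- Proposition 3.4 (key step): for point-finite open covers `𝒰 0, …, 𝒰 n` of `X`, every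
`p ∈ X` has an open neighbourhood `V` such that `Δ_{[𝒰_{≤n}]}(p) ⊆ Δ_{[𝒰_{≤n}]}(q)` for
every `q ∈ V`. -/
theorem delta_mono_of_pointFinite
    {X : Type*} [TopologicalSpace X] (n : ℕ) (𝒰 : ℕ → Set (Set X))
    (hopen : ∀ k, k ≤ n → ∀ u ∈ 𝒰 k, IsOpen u)
    (hcov : ∀ k, k ≤ n → ⋃₀ 𝒰 k = Set.univ)
    (hpf : ∀ k, k ≤ n → ∀ x : X, {u ∈ 𝒰 k | x ∈ u}.Finite)
    (p : X) :
    ∃ V : Set X, IsOpen V ∧ p ∈ V ∧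
      ∀ q ∈ V, ∀ σ : Set (Set X × ℕ), IsDeltaSimplex 𝒰 n σ →
        p ∈ ⋂ s ∈ σ, s.1 → q ∈ ⋂ s ∈ σ, s.1 := by
  refine ⟨⋂ k ∈ Set.Iic n, ⋂ u ∈ {u ∈ 𝒰 k | p ∈ u}, u, ?_, ?_, ?_⟩
  · exact (Set.finite_Iic n).isOpen_biInter fun k hk =>
      (hpf k hk p).isOpen_biInter fun u hu => hopen k hk u hu.1
  · exact Set.mem_iInter₂.2 fun k _ => Set.mem_iInter₂.2 fun u hu => hu.2
  · intro q hq σ hσ hp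
    refine Set.mem_iInter₂.2 fun s hs => ?_
    obtain ⟨hk, hu⟩ := hσ.2.2.1 s hs
    exact Set.mem_iInter₂.1 (Set.mem_iInter₂.1 hq s.2 hk) s.1 ⟨hu, Set.mem_iInter₂.1 hp s hs⟩
end

section
/- Let K_ω be the subspace of the Hilbert cube [0,1]^ω consisting of all points with only finitely many nonzero coordinates (with the topology inherited from the product topology on ℝ^ω). Then there exist a Hausdorff topological space Y and an aspherical sequence φ_n : K_ω ⇝ Y (n < ω) of lower locally constant set-valued mappings such that the union ⋃_{n<ω} φ_n has a continuous selection, but no individual mapping φ_n (n < ω) has a continuous selection. -/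
/-- `Kω`: the subspace of the Hilbert cube `[0,1]^ω` of points with only finitely many
nonzero coordinates. -/
def Komega : Set (ℕ → ℝ) :=
  {x | (∀ n, x n ∈ Set.Icc (0 : ℝ) 1) ∧ {n | x n ≠ 0}.Finite}

section
open Set Metric MeasureTheory Filter Topology

theorem ContinuousLinearMap.exists_polynomial_eval_eq_det_one_add_smul {E : Type*}
    [NormedAddCommGroup E] [NormedSpace ℝ E] [FiniteDimensional ℝ E] (A : E →L[ℝ] E) :
    ∃ P : Polynomial ℝ, P.natDegree ≤ Module.finrank ℝ E ∧
      ∀ t : ℝ, P.eval t = (1 + t • A).det := by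
  obtain ⟨b⟩ : Nonempty (Module.Basis (Fin (Module.finrank ℝ E)) ℝ E) := ⟨Module.finBasis ℝ E⟩
  let M := LinearMap.toMatrix b b (A : E →ₗ[ℝ] E)
  refine ⟨((Polynomial.X : Polynomial ℝ) • M.map Polynomial.C +
    (1 : Matrix _ _ ℝ).map Polynomial.C).det, ?_, fun t => ?_⟩
  · simpa using Polynomial.natDegree_det_X_add_C_le M 1
  · rw [ContinuousLinearMap.det, ← LinearMap.det_toMatrix b, ← Polynomial.coe_evalRingHom,
      RingHom.map_det]
    congr 1
    ext i j
    rcases eq_or_ne i j with rfl | hij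
    · simp [M, LinearMap.toMatrix_apply]
      ring
    · simp [M, LinearMap.toMatrix_apply, hij]
      ring

theorem integral_det_one_add_eq_of_eventually_eq {E X : Type*} [NormedAddCommGroup E]
    [NormedSpace ℝ E] [FiniteDimensional ℝ E] [MeasurableSpace X] {μ : Measure X}
    {A : X → E →L[ℝ] E} {c : ℝ} (hA : ∀ t : ℝ, Integrable (fun x => (1 + t • A x).det) μ)
    (hc : ∀ᶠ t in 𝓝[>] (0 : ℝ), ∫ x, (1 + t • A x).det ∂μ = c) (t : ℝ) :
    ∫ x, (1 + t • A x).det ∂μ = c := by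
  choose P hPdeg hP using
    fun x => ContinuousLinearMap.exists_polynomial_eval_eq_det_one_add_smul (A x)
  obtain ⟨u, hu, hsub⟩ := mem_nhdsGT_iff_exists_Ioo_subset.1 hc
  have hinf : {t : ℝ | ∫ x, (1 + t • A x).det ∂μ = c}.Infinite := (Ioo_infinite hu).mono hsub
  obtain ⟨s, hs, hcard⟩ := hinf.exists_subset_card_eq (Module.finrank ℝ E + 1)
  have hinterp (x : X) (t : ℝ) : (1 + t • A x).det =
      ∑ i ∈ s, (1 + i • A x).det * (Lagrange.basis s id i).eval t := by
    rw [← hP, Lagrange.eq_interpolate (f := P x) (s := s) (v := id) (injOn_id _)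
      (by
        rw [hcard]
        exact (Polynomial.degree_le_of_natDegree_le (hPdeg x)).trans_lt
          (by exact_mod_cast Nat.lt_succ_self _))]
    simp [Lagrange.interpolate_apply, Polynomial.eval_finsetSum, hP]
  have hsum : ∑ i ∈ s, (Lagrange.basis s id i).eval t = 1 := by
    rw [← Polynomial.eval_finsetSum, Lagrange.sum_basis (injOn_id _)
      (Finset.card_pos.1 (hcard ▸ Nat.succ_pos _)), Polynomial.eval_one]
  simp_rw [hinterp _ t]
  rw [integral_finsetSum _ fun i _ => (hA i).mul_const _]
  calc _ = ∑ i ∈ s, c * (Lagrange.basis s id i).eval t :=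
        Finset.sum_congr rfl fun i hi => by rw [integral_mul_const, hs hi]
    _ = c := by rw [← Finset.mul_sum, hsum, mul_one]

variable {E : Type*} [NormedAddCommGroup E] [InnerProductSpace ℝ E] [FiniteDimensional ℝ E]
  {R : E → E}

theorem det_fderiv_eq_zero_of_norm_eq_one (hR : Differentiable ℝ R) (hnorm : ∀ x, ‖R x‖ = 1)
    (x : E) : (fderiv ℝ R x).det = 0 := by
  by_contra hdet
  have hsurj : Function.Surjective (fderiv ℝ R x) := by
    have := (LinearMap.isUnit_iff_isUnit_det (fderiv ℝ R x : E →ₗ[ℝ] E)).2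
      (isUnit_iff_ne_zero.2 hdet)
    exact ((Module.End.isUnit_iff _).1 this).2
  obtain ⟨v, hv⟩ := hsurj (R x)
  have h1 := ((hR x).hasFDerivAt.norm_sq).unique
    (by simpa [hnorm] using hasFDerivAt_const (1 : ℝ) x)
  have h2 := DFunLike.congr_fun h1 v
  simp [hv, hnorm] at h2

theorem eventually_injOn_image_closedBall_eq (hR : ContDiff ℝ 1 R) (hnorm : ∀ x, ‖R x‖ = 1)
    (hout : ∀ x, 1 ≤ ‖x‖ → R x = ‖x‖⁻¹ • x) :
    ∀ᶠ t in 𝓝[>] (0 : ℝ), InjOn (fun x => x + t • (R x - x)) (closedBall 0 1) ∧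
      (fun x => x + t • (R x - x)) '' closedBall 0 1 = closedBall 0 1 := by
  obtain ⟨K, hK⟩ : ∃ K, LipschitzOnWith K (fun x => R x - x) (closedBall 0 2) :=
    (LocallyLipschitz.locallyLipschitzOn
      (hR.sub contDiff_id).locallyLipschitz).exists_lipschitzOnWith_of_compact
        (isCompact_closedBall _ _)
  have hsub : closedBall (0 : E) 1 ⊆ closedBall 0 2 := closedBall_subset_closedBall (by norm_num)
  have hsmall : ∀ᶠ t in 𝓝[>] (0 : ℝ), t * (K : ℝ) < 1 := by
    refine nhdsWithin_le_nhds (ContinuousAt.eventually_lt (by fun_prop) continuousAt_const ?_)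
    simp
  filter_upwards [hsmall, Ioo_mem_nhdsGT (show (0 : ℝ) < 1 / 3 by norm_num)] with t htK ht
  obtain ⟨ht0, ht1⟩ := ht
  have hdist {x y : E} (hx : x ∈ closedBall 0 2) (hy : y ∈ closedBall 0 2) :
      ‖t • (R x - x) - t • (R y - y)‖ ≤ t * K * ‖x - y‖ := by
    rw [← smul_sub, norm_smul, Real.norm_of_nonneg ht0.le, mul_assoc]
    exact mul_le_mul_of_nonneg_left (by simpa [dist_eq_norm] using hK.dist_le_mul x hx y hy) ht0.le
  refine ⟨fun x hx y hy hxy => ?_, Subset.antisymm ?_ fun y hy => ?_⟩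
  · have h1 := hdist (hsub hy) (hsub hx)
    have h2 : x - y = t • (R y - y) - t • (R x - x) := by
      simp only at hxy
      rw [sub_eq_sub_iff_add_eq_add, hxy, add_comm]
    rw [← h2, norm_sub_rev y x] at h1
    rw [← sub_eq_zero, ← norm_le_zero_iff]
    nlinarith [norm_nonneg (x - y)]
  · rintro _ ⟨x, hx, rfl⟩
    rw [mem_closedBall_zero_iff] at hx ⊢
    calc ‖x + t • (R x - x)‖ = ‖(1 - t) • x + t • R x‖ := by congr 1; module
      _ ≤ (1 - t) * ‖x‖ + t * 1 := by
        refine (norm_add_le _ _).trans ?_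
        rw [norm_smul, norm_smul, hnorm, Real.norm_of_nonneg ht0.le,
          Real.norm_of_nonneg (by linarith)]
      _ ≤ 1 := by nlinarith
  · rw [mem_closedBall_zero_iff] at hy
    have hmaps : MapsTo (fun x => y - t • (R x - x)) (closedBall 0 2) (closedBall 0 2) := by
      intro x hx
      rw [mem_closedBall_zero_iff] at hx ⊢
      have h1 : ‖R x - x‖ ≤ 3 := (norm_sub_le _ _).trans (by rw [hnorm]; linarith)
      refine (norm_sub_le _ _).trans ?_
      rw [norm_smul, Real.norm_of_nonneg ht0.le]
      nlinarith [norm_nonneg (R x - x)]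
    have hcontr : ContractingWith ⟨t * K, by positivity⟩ (hmaps.restrict _ _ _) := by
      refine ⟨by exact_mod_cast htK, LipschitzWith.of_dist_le_mul fun u v => ?_⟩
      have := hdist v.2 u.2
      rw [norm_sub_rev v.1] at this
      rw [Subtype.dist_eq, Subtype.dist_eq, dist_eq_norm, dist_eq_norm]
      change _ ≤ t * (K : ℝ) * _
      simpa only [MapsTo.val_restrict_apply, sub_sub_sub_cancel_left] using this
    obtain ⟨x, -, hfix, -⟩ := hcontr.exists_fixedPoint' isClosed_closedBall.isComplete hmaps
      (x := 0) (by simp) (edist_ne_top _ _)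
    have hxy : x + t • (R x - x) = y := by
      nth_rewrite 1 [← hfix.eq]
      simp
    refine ⟨x, ?_, hxy⟩
    rw [mem_closedBall_zero_iff]
    by_contra! hx
    rw [hout x hx.le] at hxy
    have h2 : y = ((1 - t) + t * ‖x‖⁻¹) • x := by rw [← hxy]; module
    have h3 : ‖y‖ = (1 - t) * ‖x‖ + t := by
      have : 0 ≤ (1 - t) + t * ‖x‖⁻¹ := by
        have := inv_nonneg.2 (norm_nonneg x)
        nlinarith
      rw [h2, norm_smul, Real.norm_of_nonneg this]
      field_simp
    nlinarith

theorem not_contDiff_retraction_sphere (hR : ContDiff ℝ 1 R) (hnorm : ∀ x, ‖R x‖ = 1)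
    (hout : ∀ x, 1 ≤ ‖x‖ → R x = ‖x‖⁻¹ • x) : False := by
  borelize E
  let B : Set E := closedBall 0 1
  let A (x : E) : E →L[ℝ] E := fderiv ℝ R x - 1
  have hA : Continuous A := (hR.continuous_fderiv one_ne_zero).sub continuous_const
  have hcont : Continuous fun p : ℝ × E => (1 + p.1 • A p.2).det :=
    ContinuousLinearMap.continuous_det.comp (by fun_prop)
  have hpos : ∀ᶠ t in 𝓝[>] (0 : ℝ), ∀ x ∈ B, 0 < (1 + t • A x).det := by
    refine nhdsWithin_le_nhds ((isCompact_closedBall _ _).eventually_forall_of_forall_eventually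
      fun x _ => ?_)
    refine hcont.continuousAt.eventually_const_lt ?_
    simp [ContinuousLinearMap.det]
  have hvol : ∀ᶠ t in 𝓝[>] (0 : ℝ), ∫ x in B, (1 + t • A x).det = volume.real B := by
    filter_upwards [hpos, eventually_injOn_image_closedBall_eq hR hnorm hout]
      with t htpos ⟨hinj, him⟩
    have h := integral_image_eq_integral_abs_det_fderiv_smul volume
      (f := fun x => x + t • (R x - x)) (f' := fun x => 1 + t • A x)
      isClosed_closedBall.measurableSet
      (fun x _ => ((hasFDerivAt_id x).add
        ((((hR.differentiable one_ne_zero) x).hasFDerivAt.sub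
          (hasFDerivAt_id x)).const_smul t)).hasFDerivWithinAt) hinj (fun _ => (1 : ℝ))
    rw [him] at h
    simp only [integral_const, smul_eq_mul, mul_one, measureReal_restrict_apply_univ] at h
    rw [h]
    exact setIntegral_congr_fun isClosed_closedBall.measurableSet
      fun x hx => (abs_of_pos (htpos x hx)).symm
  have h1 := integral_det_one_add_eq_of_eventually_eq (fun t =>
    (hcont.comp (Continuous.prodMk_right t)).continuousOn.integrableOn_compact
      (isCompact_closedBall _ _)) hvol 1
  have h0 : (fun x => (1 + (1 : ℝ) • A x).det) = 0 := by
    ext x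
    simpa [A] using det_fderiv_eq_zero_of_norm_eq_one (hR.differentiable one_ne_zero) hnorm x
  have hB : 0 < volume.real B :=
    ENNReal.toReal_pos (measure_closedBall_pos _ _ one_pos).ne' measure_closedBall_lt_top.ne
  rw [h0] at h1
  simp at h1
  exact hB.ne h1

/-- **Brouwer's fixed point theorem** for continuous maps with bounded range. -/
theorem exists_fixed_point_of_norm_le {f : E → E} (hf : Continuous f) {M : ℝ}
    (hM : ∀ x, ‖f x‖ ≤ M) : ∃ x, f x = x := by
  by_contra! hne
  have hM0 : 0 ≤ M := (norm_nonneg _).trans (hM 0)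
  obtain ⟨g, hg, hgf, -⟩ := hf.exists_contDiff_approx (ε := fun x => min 1 ‖f x - x‖) 1
    (by fun_prop) fun x => lt_min one_pos (norm_pos_iff.2 (sub_ne_zero.2 (hne x)))
  have hgne (x : E) : g x ≠ x := by
    intro h
    have := (hgf x).trans_le (min_le_right _ _)
    rw [h, dist_comm, dist_eq_norm] at this
    exact this.false
  have hgM (x : E) : ‖g x‖ < M + 1 := by
    have h1 := (hgf x).trans_le (min_le_left _ _)
    rw [dist_eq_norm] at h1
    have h2 := norm_sub_norm_le (g x) (f x)
    linarith [hM x]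
  let χ : ContDiffBump (0 : E) := ⟨M + 1, M + 2, by linarith, by linarith⟩
  let H (x : E) : E := x - χ x • g x
  have hH : ContDiff ℝ 1 H := contDiff_id.sub (χ.contDiff.smul hg)
  have hH0 (x : E) : H x ≠ 0 := by
    rcases le_or_gt ‖x‖ (M + 1) with hx | hx
    · simp only [H, χ.one_of_mem_closedBall (mem_closedBall_zero_iff.2 hx), one_smul]
      exact sub_ne_zero.2 (hgne x).symm
    · intro h
      have h1 : ‖x‖ = χ x * ‖g x‖ := by
        rw [← Real.norm_of_nonneg χ.nonneg, ← norm_smul, ← sub_eq_zero.1 h]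
      have h2 : χ x * ‖g x‖ ≤ ‖g x‖ := mul_le_of_le_one_left (norm_nonneg _) χ.le_one
      linarith [hgM x]
  have hHout {x : E} (hx : M + 2 ≤ ‖x‖) : H x = x := by
    simp [H, χ.zero_of_le_dist (by simpa [dist_eq_norm] using hx)]
  have hK : ContDiff ℝ 1 fun x => H ((M + 2) • x) := hH.comp (contDiff_const_smul _)
  refine not_contDiff_retraction_sphere
    (R := fun x => ‖H ((M + 2) • x)‖⁻¹ • H ((M + 2) • x))
    (((hK.norm ℝ fun x => hH0 _).inv fun x => norm_ne_zero_iff.2 (hH0 _)).smul hK)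
    (fun x => norm_smul_inv_norm (𝕜 := ℝ) (hH0 _)) fun x hx => ?_
  have hpos : 0 < M + 2 := by linarith
  rw [hHout (by rw [norm_smul, Real.norm_of_nonneg hpos.le]; nlinarith), norm_smul,
    Real.norm_of_nonneg hpos.le, smul_smul]
  congr 1
  field_simp

end

namespace Komega

/-- The points of `Komega` different from `x` that lie in the face of the Hilbert cube
spanned by the coordinates `0, …, n`. -/
def puncturedFace (n : ℕ) (x : Komega) : Set Komega :=
  {y | y ≠ x ∧ ∀ i, n < i → y.1 i = 0}

/-- The point of `Komega` obtained from `v` by clamping the coordinates `0, …, n` to `[0, 1]`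
and replacing the others by zero. -/
noncomputable def clamp (n : ℕ) (v : ℕ → ℝ) : Komega :=
  ⟨fun i => if i ≤ n then Set.projIcc (0 : ℝ) 1 zero_le_one (v i) else 0,
    fun i => by
      dsimp only
      split_ifs
      · exact Subtype.prop _
      · simp,
    (Set.finite_Iic n).subset fun i hi => by
      by_contra h
      exact hi (if_neg h)⟩

theorem clamp_apply (n : ℕ) (v : ℕ → ℝ) (i : ℕ) :
    (clamp n v).1 i = if i ≤ n then (Set.projIcc (0 : ℝ) 1 zero_le_one (v i) : ℝ) else 0 :=
  rfl

theorem continuous_clamp (n : ℕ) : Continuous (clamp n) := by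
  refine Continuous.subtype_mk (continuous_pi fun i => ?_) _
  split_ifs
  · exact continuous_subtype_val.comp (continuous_projIcc.comp (continuous_apply i))
  · exact continuous_const

theorem clamp_eq_self {n : ℕ} {x : Komega} (hx : ∀ i, n < i → x.1 i = 0) : clamp n x.1 = x := by
  ext i
  rw [clamp_apply]
  split_ifs with h
  · rw [Set.projIcc_of_mem _ (x.2.1 i)]
  · exact (hx i (not_le.1 h)).symm

theorem clamp_congr {n : ℕ} {v w : ℕ → ℝ} (h : ∀ i ≤ n, v i = w i) : clamp n v = clamp n w := by
  ext i
  simp only [clamp_apply]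
  split_ifs with hi
  · rw [h i hi]
  · rfl

/-- Prepend the coordinate `1`. -/
noncomputable def consOne (x : Komega) : Komega :=
  ⟨fun i => Nat.casesOn i 1 x.1, fun i => by
    cases i with
    | zero => simp
    | succ i => exact x.2.1 i,
    ((x.2.2.image Nat.succ).insert 0).subset fun i hi => by
      cases i with
      | zero => simp
      | succ i => exact Or.inr ⟨i, hi, rfl⟩⟩

theorem continuous_consOne : Continuous consOne := by
  refine Continuous.subtype_mk (continuous_pi fun i => ?_) _
  cases i with
  | zero => exact continuous_const
  | succ i => exact (continuous_apply i).comp continuous_subtype_val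

theorem consOne_ne (x : Komega) : consOne x ≠ x := by
  intro h
  have hone (i : ℕ) : x.1 i = 1 := by
    induction i with
    | zero => rw [← h]; rfl
    | succ i ih => rw [← h]; exact ih
  exact Set.infinite_univ (x.2.2.subset fun i _ => by simp [hone i])

theorem exists_forall_lt_eq_zero (x : Komega) : ∃ n, ∀ i, n < i → x.1 i = 0 := by
  obtain ⟨n, hn⟩ := x.2.2.bddAbove
  exact ⟨n, fun i hi => by_contra fun h => (hn h).not_gt hi⟩

theorem puncturedFace_nonempty (n : ℕ) (x : Komega) : (puncturedFace n x).Nonempty := by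
  by_cases hx : x = clamp n 0
  · refine ⟨clamp n 1, fun h => ?_, fun i hi => if_neg hi.not_ge⟩
    have := congrFun (congrArg Subtype.val (h.trans hx)) 0
    simp [clamp_apply] at this
  · exact ⟨clamp n 0, Ne.symm hx, fun i hi => if_neg hi.not_ge⟩

theorem lowerLocallyConstant_puncturedFace (n : ℕ) :
    LowerLocallyConstant (puncturedFace n) := by
  intro K hK
  by_cases h : ∀ y ∈ K, ∀ i, n < i → y.1 i = 0
  · convert hK.isClosed.isOpen_compl using 1
    ext x
    exact ⟨fun hx hxK => (hx hxK).1 rfl, fun hx y hy => ⟨fun hyx => hx (hyx ▸ hy), h y hy⟩⟩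
  · convert isOpen_empty
    exact Set.eq_empty_of_forall_notMem fun x hx => h fun y hy => (hx hy).2

theorem embedIn_puncturedFace (k n : ℕ) (x : Komega) :
    EmbedIn k (puncturedFace n x) (puncturedFace (n + 1) x) := by
  intro f hf hfS
  have hemb := Topology.IsClosedEmbedding.inclusion
    (Metric.sphere_subset_closedBall (x := (0 : EuclideanSpace ℝ (Fin (k + 1)))) (ε := 1))
    (Metric.isClosed_sphere.preimage continuous_subtype_val)
  obtain ⟨G, hG⟩ := ContinuousMap.exists_extension' hemb
    (⟨fun z => (f z).1, continuous_subtype_val.comp hf⟩ : C(_, ℕ → ℝ))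
  replace hG (z) : G (Set.inclusion Metric.sphere_subset_closedBall z) = (f z).1 := congrFun hG z
  by_cases hx : ∀ i, n < i → x.1 i = 0
  · let v (z : Metric.closedBall (0 : EuclideanSpace ℝ (Fin (k + 1))) 1) : ℕ → ℝ :=
      Function.update (clamp n (G z)).1 (n + 1) (1 - ‖z.1‖)
    have hv : Continuous v := (continuous_subtype_val.comp
      ((continuous_clamp n).comp G.continuous)).update (n + 1)
        (continuous_const.sub continuous_subtype_val.norm)
    have hbdry (z) : clamp (n + 1) (v (Set.inclusion Metric.sphere_subset_closedBall z)) = f z := by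
      have hz : ‖z.1‖ = 1 := by simp
      have hfz := (hfS (Set.mem_range_self z)).2
      have : v (Set.inclusion Metric.sphere_subset_closedBall z) = (f z).1 := by
        simp only [v, hG, clamp_eq_self hfz]
        rw [Function.update_eq_self_iff, hfz _ (Nat.lt_succ_self n)]
        simp [hz]
      rw [this, clamp_eq_self fun i hi => hfz i (by omega)]
    refine ⟨fun z => clamp (n + 1) (v z), (continuous_clamp _).comp hv, ?_, hbdry⟩
    rintro _ ⟨z, rfl⟩
    refine ⟨?_, fun i hi => if_neg hi.not_ge⟩
    have hz : ‖z.1‖ ≤ 1 := mem_closedBall_zero_iff.1 z.2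
    rcases hz.eq_or_lt with hz1 | hz1
    · have hfz : clamp (n + 1) (v z) = _ := hbdry ⟨z.1, by simpa using hz1⟩
      exact fun h => (hfS (Set.mem_range_self _)).1 (hfz.symm.trans h)
    · intro h
      have h1 := congrFun (congrArg Subtype.val h) (n + 1)
      rw [hx _ (Nat.lt_succ_self n), clamp_apply, if_pos le_rfl,
        show v z (n + 1) = 1 - ‖z.1‖ from Function.update_self ..,
        Set.projIcc_of_mem _ ⟨by linarith, by linarith [norm_nonneg z.1]⟩] at h1
      linarith
  · refine ⟨fun z => clamp n (G z), (continuous_clamp n).comp G.continuous, ?_, fun z => ?_⟩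
    · rintro _ ⟨z, rfl⟩
      exact ⟨fun h => hx (h ▸ fun i hi => if_neg hi.not_ge),
        fun i hi => if_neg (by omega)⟩
    · simp only [hG, clamp_eq_self (hfS (Set.mem_range_self z)).2]

theorem exists_notMem_puncturedFace (n : ℕ) {s : Komega → Komega} (hs : Continuous s) :
    ∃ x, s x ∉ puncturedFace n x := by
  let ι (v : EuclideanSpace ℝ (Fin (n + 1))) : Komega :=
    clamp n fun i => if h : i < n + 1 then v ⟨i, h⟩ else 0
  have hι : Continuous ι := by
    refine (continuous_clamp n).comp (continuous_pi fun i => ?_)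
    split_ifs
    · fun_prop
    · exact continuous_const
  let F (v : EuclideanSpace ℝ (Fin (n + 1))) : EuclideanSpace ℝ (Fin (n + 1)) :=
    WithLp.toLp 2 fun j => (s (ι v)).1 j
  have hF : Continuous F := by
    refine (PiLp.continuous_toLp 2 _).comp (continuous_pi fun j => ?_)
    exact (continuous_apply _).comp (continuous_subtype_val.comp (hs.comp hι))
  have hbound (v) : ‖F v‖ ≤ √(n + 1) := by
    rw [EuclideanSpace.norm_eq]
    refine Real.sqrt_le_sqrt ?_
    calc ∑ j, ‖F v j‖ ^ 2 ≤ ∑ _j : Fin (n + 1), (1 : ℝ) := by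
          refine Finset.sum_le_sum fun j _ => ?_
          have := (s (ι v)).2.1 j
          exact pow_le_one₀ (norm_nonneg _)
            ((Real.norm_of_nonneg this.1).trans_le this.2)
      _ = n + 1 := by simp
  obtain ⟨v, hv⟩ := exists_fixed_point_of_norm_le hF hbound
  refine ⟨ι v, fun h => h.1 ?_⟩
  rw [← clamp_eq_self h.2]
  refine clamp_congr fun i hi => ?_
  rw [dif_pos (Nat.lt_succ_of_le hi)]
  exact congrArg (fun w => w.ofLp ⟨i, Nat.lt_succ_of_le hi⟩) hv

end Komega

/-- Example 6.4: there is a Hausdorff space `Y` and an aspherical sequence of lower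
locally constant mappings on `Kω` whose union has a continuous selection, while no
individual member of the sequence has one. -/
theorem komega_asphericalSequence_union_selection_not_member_selection :
    ∃ (Y : Type) (_ : TopologicalSpace Y) (_ : T2Space Y) (φ : ℕ → Komega → Set Y),
      (∀ n x, (φ n x).Nonempty) ∧
      (∀ n, LowerLocallyConstant (φ n)) ∧
      (∀ n x, EmbedIn n (φ n x) (φ (n + 1) x)) ∧
      (∃ f : Komega → Y, Continuous f ∧ ∀ x, f x ∈ ⋃ n, φ n x) ∧
      (∀ n : ℕ, ¬ ∃ f : Komega → Y, Continuous f ∧ ∀ x, f x ∈ φ n x) := by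
  refine ⟨Komega, inferInstance, inferInstance, Komega.puncturedFace,
    Komega.puncturedFace_nonempty, Komega.lowerLocallyConstant_puncturedFace,
    fun n => Komega.embedIn_puncturedFace n n,
    ⟨Komega.consOne, Komega.continuous_consOne, fun x => ?_⟩, ?_⟩
  · obtain ⟨n, hn⟩ := Komega.exists_forall_lt_eq_zero (Komega.consOne x)
    exact Set.mem_iUnion.2 ⟨n, Komega.consOne_ne x, hn⟩
  · rintro n ⟨s, hs, hsel⟩
    obtain ⟨x, hx⟩ := Komega.exists_notMem_puncturedFace n hs
    exact hx (hsel x)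
end

section
/- Let X be a paracompact Hausdorff C-space, Y a Hausdorff topological space, and Φ : X ⇝ Y a lower locally constant set-valued mapping such that Φ(x) is an aspherical subset of Y for every x ∈ X. Then Φ has a continuous selection. -/
/-- `X` is a C-space. -/
def IsCSpace (X : Type*) [TopologicalSpace X] : Prop :=
  ∀ U : ℕ → Set (Set X),
    (∀ n, (∀ u ∈ U n, IsOpen u) ∧ ⋃₀ U n = Set.univ) →
      ∃ V : ℕ → Set (Set X),
        (∀ n, ∀ v ∈ V n, IsOpen v) ∧
        (∀ n, (V n).Pairwise Disjoint) ∧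
        (∀ n, ∀ v ∈ V n, ∃ u ∈ U n, v ⊆ u) ∧
        (⋃ n, ⋃₀ V n) = Set.univ

open Set Topology

section CubeExtension

variable {Y : Type*} [TopologicalSpace Y]

/-- Maps from the boundary of the cube `[0,1]^(k+1)` extend over the cube, if maps from the
`k`-sphere extend over the ball. -/
theorem EmbedIn.exists_extension_Icc {k : ℕ} {S B : Set Y} (h : EmbedIn k S B)
    {φ : (Fin (k + 1) → ℝ) → Y} (hφ : ContinuousOn φ (frontier (Icc 0 1)))
    (hS : MapsTo φ (frontier (Icc 0 1)) S) :
    ∃ g : (Fin (k + 1) → ℝ) → Y, ContinuousOn g (Icc 0 1) ∧ MapsTo g (Icc 0 1) B ∧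
      EqOn g φ (frontier (Icc 0 1)) := by
  let L : EuclideanSpace ℝ (Fin (k + 1)) ≃L[ℝ] (Fin (k + 1) → ℝ) := EuclideanSpace.equiv _ ℝ
  let T := L.toHomeomorph
  obtain ⟨H, -, hcl, hfr⟩ := exists_homeomorph_image_interior_closure_frontier_eq_unitBall
    (s := L ⁻¹' Icc 0 1)
    ((convex_Icc (0 : Fin (k + 1) → ℝ) 1).is_linear_preimage L.toLinearEquiv.toLinearMap.isLinear)
    (by
      have : (interior (T ⁻¹' Icc 0 1)).Nonempty := by
        rw [← T.preimage_interior]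
        refine Nonempty.preimage ?_ T.surjective
        rw [← pi_univ_Icc, interior_pi_set finite_univ]
        exact ⟨fun _ => 1 / 2, fun i _ => by norm_num [interior_Icc]⟩
      exact this)
    (by
      have : IsCompact (T ⁻¹' Icc 0 1) := T.isCompact_preimage.2 isCompact_Icc
      exact this.isBounded)
  have hclosed : closure (L ⁻¹' Icc 0 1) = L ⁻¹' Icc 0 1 :=
    (isClosed_Icc.preimage L.continuous).closure_eq
  have hfront : frontier (L ⁻¹' Icc 0 1) = L ⁻¹' frontier (Icc 0 1) :=
    (T.preimage_frontier _).symm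
  rw [hclosed] at hcl
  rw [hfront] at hfr
  have key : ∀ z ∈ Metric.sphere (0 : EuclideanSpace ℝ (Fin (k + 1))) 1,
      L (H.symm z) ∈ frontier (Icc 0 1) := by
    intro z hz
    rw [← hfr] at hz
    obtain ⟨y, hy, rfl⟩ := hz
    simpa using hy
  have hcont : Continuous fun z : Metric.sphere (0 : EuclideanSpace ℝ (Fin (k + 1))) 1 =>
      φ (L (H.symm z)) :=
    hφ.comp_continuous (L.continuous.comp (H.symm.continuous.comp continuous_subtype_val))
      fun z => key z z.2
  obtain ⟨g, hg, hgB, hgφ⟩ := h _ hcont (by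
    rintro _ ⟨z, rfl⟩
    exact hS (key z z.2))
  have hmem : ∀ a ∈ Icc (0 : Fin (k + 1) → ℝ) 1, H (L.symm a) ∈ Metric.closedBall 0 1 := by
    intro a ha
    rw [← hcl]
    exact ⟨_, by simpa using ha, rfl⟩
  classical
  have y₀ : Y := g ⟨0, by simp⟩
  refine ⟨fun a => if ha : a ∈ Icc (0 : Fin (k + 1) → ℝ) 1 then g ⟨_, hmem a ha⟩ else y₀,
    ?_, ?_, ?_⟩
  · rw [continuousOn_iff_continuous_domRestrict]
    have : Continuous fun a : Icc (0 : Fin (k + 1) → ℝ) 1 => g ⟨_, hmem a a.2⟩ := by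
      refine hg.comp (Continuous.subtype_mk ?_ _)
      exact H.continuous.comp (L.symm.continuous.comp continuous_subtype_val)
    refine this.congr fun a => ?_
    have := a.2
    simp only [domRestrict_apply]
    rw [dif_pos this]
  · intro a ha
    simp only [dif_pos ha]
    exact hgB ⟨_, rfl⟩
  · intro a ha
    have ha' : a ∈ Icc (0 : Fin (k + 1) → ℝ) 1 := isClosed_Icc.frontier_subset ha
    have hs : H (L.symm a) ∈ Metric.sphere (0 : EuclideanSpace ℝ (Fin (k + 1))) 1 := by
      rw [← hfr]
      exact ⟨_, by simpa using ha, rfl⟩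
    simp only [dif_pos ha']
    have := hgφ ⟨_, hs⟩
    simp only [Homeomorph.symm_apply_apply, ContinuousLinearEquiv.apply_symm_apply] at this
    exact this

theorem mem_frontier_Icc_zero_one {ι : Type*} [Finite ι] {a : ι → ℝ} :
    a ∈ frontier (Icc (0 : ι → ℝ) 1) ↔ a ∈ Icc (0 : ι → ℝ) 1 ∧ ∃ i, a i = 0 ∨ a i = 1 := by
  rw [isClosed_Icc.frontier_eq, mem_sdiff, ← pi_univ_Icc, interior_pi_set finite_univ]
  refine and_congr_right fun ha => ?_
  simp only [Pi.zero_apply, Pi.one_apply, interior_Icc, mem_pi, mem_univ, true_imp_iff, mem_Ioo,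
    not_forall]
  refine exists_congr fun i => ?_
  have := ha i (mem_univ i)
  simp only [Pi.zero_apply, Pi.one_apply, mem_Icc] at this
  grind

variable {V : Type*}

/-- The cube `[0,1]^σ`, seen as a set of functions on `V` vanishing outside `σ`. -/
def weightCube (σ : Finset V) : Set (V → ℝ) :=
  {a | ∀ v, a v ∈ Icc (0 : ℝ) 1 ∧ (v ∉ σ → a v = 0)}

/-- The union of the faces of the cube `[0,1]^σ` not containing the origin. -/
def weightTop (σ : Finset V) : Set (V → ℝ) :=
  {a | a ∈ weightCube σ ∧ ∃ v, a v = 1}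

theorem weightTop_subset (σ : Finset V) : weightTop σ ⊆ weightCube σ := fun _ h => h.1

theorem weightCube_mono {σ τ : Finset V} (h : σ ⊆ τ) : weightCube σ ⊆ weightCube τ :=
  fun _ ha v => ⟨(ha v).1, fun hv => (ha v).2 fun hσ => hv (h hσ)⟩

theorem isCompact_weightCube (σ : Finset V) : IsCompact (weightCube σ) := by
  classical
  have : weightCube σ = univ.pi fun v => if v ∈ σ then Icc (0 : ℝ) 1 else {0} := by
    ext a
    simp only [weightCube, mem_ofPred_eq, mem_pi, mem_univ, true_imp_iff]
    refine forall_congr' fun v => ?_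
    by_cases hv : v ∈ σ
    · simp [hv]
    · simp only [hv, not_false_eq_true, true_imp_iff, if_false, mem_singleton_iff]
      exact ⟨fun h => h.2, fun h => by simp [h]⟩
  rw [this]
  refine isCompact_univ_pi fun v => ?_
  split_ifs
  exacts [isCompact_Icc, isCompact_singleton]

theorem isClosed_weightCube (σ : Finset V) : IsClosed (weightCube σ) :=
  (isCompact_weightCube σ).isClosed

theorem isClosed_weightTop (σ : Finset V) : IsClosed (weightTop σ) := by
  have : weightTop σ = weightCube σ ∩ ⋃ v ∈ σ, {a | a v = 1} := by
    ext a
    simp only [weightTop, mem_ofPred_eq, mem_inter_iff, mem_iUnion, exists_prop]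
    refine and_congr_right fun ha => exists_congr fun v => ?_
    refine ⟨fun h => ⟨?_, h⟩, fun h => h.2⟩
    by_contra hv
    linarith [(ha v).2 hv]
  rw [this]
  refine (isClosed_weightCube σ).inter (σ.finite_toSet.isClosed_biUnion fun v _ => ?_)
  exact isClosed_eq (continuous_apply v) continuous_const

/-- The boundary of the cube `[0,1]^σ`. -/
def weightBoundary (σ : Finset V) : Set (V → ℝ) :=
  {a | a ∈ weightCube σ ∧ ∃ v ∈ σ, a v = 0 ∨ a v = 1}

theorem EmbedIn.exists_extension_weightCube {k : ℕ} {S B : Set Y} (h : EmbedIn k S B)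
    {σ : Finset V} (hσ : σ.card = k + 1)
    {φ : (V → ℝ) → Y} (hφ : ContinuousOn φ (weightBoundary σ))
    (hS : MapsTo φ (weightBoundary σ) S) :
    ∃ g : (V → ℝ) → Y, ContinuousOn g (weightCube σ) ∧ MapsTo g (weightCube σ) B ∧
      EqOn g φ (weightBoundary σ) := by
  classical
  let e : σ ≃ Fin (k + 1) := σ.equivFinOfCardEq hσ
  let ι : (Fin (k + 1) → ℝ) → V → ℝ := fun b v => if hv : v ∈ σ then b (e ⟨v, hv⟩) else 0
  let r : (V → ℝ) → Fin (k + 1) → ℝ := fun a i => a (e.symm i)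
  have hι : Continuous ι := by
    refine continuous_pi fun v => ?_
    by_cases hv : v ∈ σ
    · simpa [ι, hv] using continuous_apply _
    · simpa [ι, hv] using continuous_const
  have hr : Continuous r := continuous_pi fun i => continuous_apply _
  have hιe : ∀ b i, ι b (e.symm i) = b i := by
    intro b i
    simp [ι]
  have hιr : ∀ a ∈ weightCube σ, ι (r a) = a := by
    intro a ha
    ext v
    by_cases hv : v ∈ σ
    · simp [ι, r, hv]
    · simp [ι, hv, (ha v).2 hv]
  have hr_mem : MapsTo r (weightCube σ) (Icc 0 1) := fun a ha =>
    ⟨fun i => (ha _).1.1, fun i => (ha _).1.2⟩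
  have hr_fr : MapsTo r (weightBoundary σ) (frontier (Icc 0 1)) := by
    rintro a ⟨ha, v, hv, hv'⟩
    rw [mem_frontier_Icc_zero_one]
    exact ⟨hr_mem ha, e ⟨v, hv⟩, by simpa [r] using hv'⟩
  have hι_fr : MapsTo ι (frontier (Icc 0 1)) (weightBoundary σ) := by
    intro b hb
    rw [mem_frontier_Icc_zero_one] at hb
    obtain ⟨hb, i, hi⟩ := hb
    refine ⟨fun v => ⟨?_, fun hv => by simp [ι, hv]⟩, e.symm i, (e.symm i).2, ?_⟩
    · by_cases hv : v ∈ σ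
      · simpa [ι, hv] using ⟨hb.1 _, hb.2 _⟩
      · simp [ι, hv]
    · rwa [hιe]
  obtain ⟨g, hg, hgB, hgφ⟩ := h.exists_extension_Icc (φ := φ ∘ ι)
    (hφ.comp hι.continuousOn hι_fr) (hS.comp hι_fr)
  refine ⟨g ∘ r, hg.comp hr.continuousOn hr_mem, hgB.comp hr_mem, fun a ha => ?_⟩
  rw [Function.comp_apply, hgφ (hr_fr ha), Function.comp_apply, hιr a ha.1]

end CubeExtension

section Cone

variable {Y : Type*} [TopologicalSpace Y] {V : Type*}

/-- A map into an aspherical set defined on the complex of top faces of the cubes `[0,1]^σ`,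
`σ ∈ K`, extends to all the cubes `[0,1]^σ` with `σ ∈ K` of cardinality at most `k`. -/
theorem exists_extension_cone {K : Set (Finset V)} (hK : ∀ σ ∈ K, ∀ τ ⊆ σ, τ ∈ K) {S : Set Y}
    (hne : S.Nonempty) (hS : ∀ k, EmbedIn k S S) {f : (V → ℝ) → Y}
    (hf : ∀ σ ∈ K, ContinuousOn f (weightTop σ)) (hfS : ∀ σ ∈ K, MapsTo f (weightTop σ) S)
    (k : ℕ) :
    ∃ h : (V → ℝ) → Y, ∀ σ ∈ K, σ.card ≤ k →
      ContinuousOn h (weightCube σ) ∧ MapsTo h (weightCube σ) S ∧ EqOn h f (weightTop σ) := by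
  classical
  have : Nonempty Y := ⟨hne.some⟩
  induction k with
  | zero =>
    obtain ⟨y, hy⟩ := hne
    refine ⟨fun _ => y, fun σ _ hc => ⟨continuousOn_const, fun _ _ => hy, ?_⟩⟩
    rintro a ⟨ha, v, hv⟩
    have : a v = 0 := (ha v).2 (by simp_all)
    linarith
  | succ k ih =>
    obtain ⟨h, hh⟩ := ih
    let φ : (V → ℝ) → Y := fun a => if ∃ v, a v = 1 then f a else h a
    have hφf : ∀ σ, EqOn φ f (weightTop σ) := fun σ a ha => if_pos ha.2
    have hφh : ∀ σ ∈ K, σ.card ≤ k → EqOn φ h (weightCube σ) := by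
      intro σ hσ hc a ha
      by_cases h1 : ∃ v, a v = 1
      · rw [hφf σ ⟨ha, h1⟩, (hh σ hσ hc).2.2 ⟨ha, h1⟩]
      · exact if_neg h1
    have hsub : ∀ σ : Finset V,
        weightBoundary σ = weightTop σ ∪ ⋃ v ∈ σ, weightCube (σ.erase v) := by
      intro σ
      ext a
      simp only [mem_union, mem_iUnion, exists_prop]
      constructor
      · rintro ⟨ha, v, hv, h0 | h1⟩
        · refine Or.inr ⟨v, hv, fun w => ⟨(ha w).1, fun hw => ?_⟩⟩
          rcases eq_or_ne w v with rfl | hwv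
          · exact h0
          · exact (ha w).2 fun hw' => hw (Finset.mem_erase.2 ⟨hwv, hw'⟩)
        · exact Or.inl ⟨ha, v, h1⟩
      · rintro (⟨ha, v, hv⟩ | ⟨v, hv, ha⟩)
        · refine ⟨ha, v, ?_, Or.inr hv⟩
          by_contra hvσ
          linarith [(ha v).2 hvσ]
        · exact ⟨weightCube_mono (σ.erase_subset v) ha, v, hv,
            Or.inl ((ha v).2 (σ.notMem_erase v))⟩
    have hext : ∀ σ ∈ K, σ.card = k + 1 → ∃ g : (V → ℝ) → Y,
        ContinuousOn g (weightCube σ) ∧ MapsTo g (weightCube σ) S ∧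
          EqOn g φ (weightBoundary σ) := by
      intro σ hσ hc
      have he : ∀ v ∈ σ, (σ.erase v).card ≤ k := fun v hv => by
        rw [Finset.card_erase_of_mem hv, hc]; rfl
      have heK : ∀ v, σ.erase v ∈ K := fun v => hK σ hσ _ (σ.erase_subset v)
      refine (hS k).exists_extension_weightCube hc ?_ ?_
      · rw [hsub]
        refine ContinuousOn.union_of_isClosed ((hf σ hσ).congr (hφf σ)) ?_
          (isClosed_weightTop σ)
          (σ.finite_toSet.isClosed_biUnion fun v _ => isClosed_weightCube _)
        have : (⋃ v ∈ σ, weightCube (σ.erase v)) = ⋃ v : σ, weightCube (σ.erase v) := by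
          rw [iUnion_subtype]
        rw [this]
        refine (locallyFinite_of_finite _).continuousOn_iUnion
          (fun v => isClosed_weightCube _) fun v => ?_
        exact (hh _ (heK v) (he v v.2)).1.congr (hφh _ (heK v) (he v v.2))
      · rw [hsub]
        rintro a (ha | ha)
        · rw [hφf σ ha]
          exact hfS σ hσ ha
        · simp only [mem_iUnion, exists_prop] at ha
          obtain ⟨v, hv, ha⟩ := ha
          rw [hφh _ (heK v) (he v hv) ha]
          exact (hh _ (heK v) (he v hv)).2.1 ha
    choose! g hgc hgS hgφ using hext
    let P : (V → ℝ) → Finset V → Prop := fun a σ =>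
      σ ∈ K ∧ σ.card = k + 1 ∧ ∀ v, a v ≠ 0 ↔ v ∈ σ
    let h' : (V → ℝ) → Y := fun a => if hP : ∃ σ, P a σ then g hP.choose a else φ a
    have h'pos : ∀ a σ, P a σ → h' a = g σ a := by
      intro a σ hP
      have hex : ∃ σ, P a σ := ⟨σ, hP⟩
      have : hex.choose = σ := by
        ext v
        rw [← hex.choose_spec.2.2 v, hP.2.2 v]
      change (if hP : ∃ σ, P a σ then g hP.choose a else φ a) = _
      rw [dif_pos hex, this]
    have h'neg : ∀ σ : Finset V, σ.card ≤ k → EqOn h' φ (weightCube σ) := by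
      intro σ hc a ha
      refine dif_neg ?_
      rintro ⟨τ, hτ, hτc, hτa⟩
      have : τ ⊆ σ := by
        intro v hv
        by_contra hvσ
        exact (hτa v).2 hv ((ha v).2 hvσ)
      have := Finset.card_le_card this
      omega
    refine ⟨h', fun σ hσ hc => ?_⟩
    rcases Nat.le_succ_iff.1 hc with hc | hc
    · have heq : EqOn h' h (weightCube σ) := (h'neg σ hc).trans (hφh σ hσ hc)
      obtain ⟨h1, h2, h3⟩ := hh σ hσ hc
      exact ⟨h1.congr heq, h2.congr heq.symm, (heq.mono (weightTop_subset σ)).trans h3⟩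
    · have heq : EqOn h' (g σ) (weightCube σ) := by
        intro a ha
        by_cases hz : ∃ v ∈ σ, a v = 0
        · obtain ⟨v, hv, hav⟩ := hz
          rw [hgφ σ hσ hc ⟨ha, v, hv, Or.inl hav⟩]
          refine h'neg (σ.erase v) ?_ fun w => ⟨(ha w).1, fun hw => ?_⟩
          · rw [Finset.card_erase_of_mem hv, hc]; rfl
          · rcases eq_or_ne w v with rfl | hwv
            · exact hav
            · exact (ha w).2 fun hw' => hw (Finset.mem_erase.2 ⟨hwv, hw'⟩)
        · push Not at hz
          refine h'pos a σ ⟨hσ, hc, fun v => ⟨fun hv => ?_, hz v⟩⟩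
          by_contra hvσ
          exact hv ((ha v).2 hvσ)
      refine ⟨(hgc σ hσ hc).congr heq, (hgS σ hσ hc).congr heq.symm, ?_⟩
      refine (heq.mono (weightTop_subset σ)).trans (EqOn.trans ?_ (hφf σ))
      refine (hgφ σ hσ hc).mono ?_
      rw [hsub]
      exact subset_union_left

end Cone

section PartialSelection

variable {X Y : Type*}

/-- The chains of length at most `n` at `x`: finite sets of indices, at most one in each of the
families `C i`, `i < n`, such that all the corresponding sets contain `x`. -/
def chainsAt (n : ℕ) (C : ℕ → X → Set X) (x : X) : Set (Finset (ℕ × X)) :=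
  {σ | (∀ v ∈ σ, v.1 < n ∧ x ∈ C v.1 v.2) ∧ InjOn Prod.fst (σ : Set (ℕ × X))}

theorem chainsAt_of_subset {n : ℕ} {C : ℕ → X → Set X} {x : X} {σ τ : Finset (ℕ × X)}
    (hσ : σ ∈ chainsAt n C x) (h : τ ⊆ σ) : τ ∈ chainsAt n C x :=
  ⟨fun v hv => hσ.1 v (h hv), hσ.2.mono (Finset.coe_subset.2 h)⟩

theorem card_le_of_mem_chainsAt {n : ℕ} {C : ℕ → X → Set X} {x : X} {σ : Finset (ℕ × X)}
    (hσ : σ ∈ chainsAt n C x) : σ.card ≤ n := by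
  simpa using Finset.card_le_card_of_injOn (t := Finset.range n) Prod.fst
    (fun v hv => by simpa using (hσ.1 v hv).1) hσ.2

variable [TopologicalSpace X] [TopologicalSpace Y]

theorem finite_chainsAt {n : ℕ} {C : ℕ → X → Set X} (hC : ∀ i < n, LocallyFinite (C i)) (x : X) :
    (chainsAt n C x).Finite := by
  have hT : (⋃ i ∈ Finset.range n, Prod.mk i '' {z | x ∈ C i z}).Finite :=
    (Finset.finite_toSet _).biUnion fun i hi =>
      ((hC i (by simpa using hi)).point_finite x).image _
  refine (hT.toFinset.powerset.finite_toSet).subset fun σ hσ => ?_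
  simp only [Finset.coe_powerset, mem_preimage, mem_powerset_iff, Finite.coe_toFinset]
  intro v hv
  simp only [mem_iUnion]
  exact ⟨v.1, by simpa using (hσ.1 v hv).1, v.2, (hσ.1 v hv).2, rfl⟩

/-- `C` consists of `n` locally finite closed covers with interiors covering `X`, and `G` maps the
top faces of the cubes spanned by chains at `x` continuously to `Φ x`. -/
structure IsPartialSelection (Φ : X → Set Y) (n : ℕ) (C : ℕ → X → Set X)
    (G : (ℕ × X → ℝ) → Y) : Prop where
  locallyFinite : ∀ i < n, LocallyFinite (C i)
  isClosed : ∀ i < n, ∀ z, IsClosed (C i z)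
  cover : ∀ i < n, ⋃ z, interior (C i z) = univ
  continuousOn : ∀ x, ∀ σ ∈ chainsAt n C x, ContinuousOn G (weightTop σ)
  mapsTo : ∀ x, ∀ σ ∈ chainsAt n C x, MapsTo G (weightTop σ) (Φ x)

theorem IsPartialSelection.exists_succ [T2Space X] [ParacompactSpace X] {Φ : X → Set Y}
    (hne : ∀ x, (Φ x).Nonempty) (hllc : LowerLocallyConstant Φ)
    (hasph : ∀ x, ∀ k : ℕ, EmbedIn k (Φ x) (Φ x)) {n : ℕ} {C : ℕ → X → Set X}
    {G : (ℕ × X → ℝ) → Y} (hG : IsPartialSelection Φ n C G) :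
    ∃ (C' : ℕ → X → Set X) (G' : (ℕ × X → ℝ) → Y), IsPartialSelection Φ (n + 1) C' G' ∧
      (∀ i < n, C' i = C i) ∧ ∀ a : ℕ × X → ℝ, (∀ v, a v ≠ 0 → v.1 < n) → G' a = G a := by
  classical
  have hcone : ∀ x, ∃ h : (ℕ × X → ℝ) → Y, ∀ σ ∈ chainsAt n C x,
      ContinuousOn h (weightCube σ) ∧ MapsTo h (weightCube σ) (Φ x) ∧
        EqOn h G (weightTop σ) := by
    intro x
    obtain ⟨h, hh⟩ := exists_extension_cone (K := chainsAt n C x)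
      (fun σ hσ τ hτ => chainsAt_of_subset hσ hτ) (hne x) (hasph x) (hG.continuousOn x)
      (hG.mapsTo x) n
    exact ⟨h, fun σ hσ => hh σ hσ (card_le_of_mem_chainsAt hσ)⟩
  choose h hc hm he using hcone
  let O : X → Set X := fun x => {x' | (⋃ σ ∈ chainsAt n C x, h x '' weightCube σ) ⊆ Φ x'} ∩
    ⋂ i ∈ Finset.range n, (⋃ z : {z // x ∉ C i z}, C i z)ᶜ
  have hO : ∀ x, IsOpen (O x) := by
    intro x
    refine (hllc _ ?_).inter ?_
    · exact (finite_chainsAt hG.locallyFinite x).isCompact_biUnion fun σ hσ =>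
        (isCompact_weightCube σ).image_of_continuousOn (hc x σ hσ)
    · refine (Finset.finite_toSet _).isOpen_biInter fun i hi => ?_
      have hi : i < n := by simpa using hi
      exact (((hG.locallyFinite i hi).comp_injective Subtype.val_injective).isClosed_iUnion
        fun z => hG.isClosed i hi z.1).isOpen_compl
  have hxO : ∀ x, x ∈ O x := by
    intro x
    refine ⟨?_, ?_⟩
    · simp only [mem_ofPred_eq, iUnion_subset_iff]
      exact fun σ hσ => (hm x σ hσ).image_subset
    · simp
  obtain ⟨u, huo, huc, hulf, huO⟩ := precise_refinement O hO
    (iUnion_eq_univ_iff.2 fun x => ⟨x, hxO x⟩)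
  obtain ⟨w, hwc, hwo, hwu⟩ := exists_iUnion_eq_closure_subset huo hulf.point_finite huc
  have hchain : ∀ x z, x ∈ O z → ∀ σ ∈ chainsAt n C x, σ ∈ chainsAt n C z := by
    intro x z hxz σ hσ
    refine ⟨fun v hv => ⟨(hσ.1 v hv).1, ?_⟩, hσ.2⟩
    by_contra hvz
    have := hxz.2
    simp only [mem_iInter, Finset.mem_range] at this
    exact this v.1 (hσ.1 v hv).1 (mem_iUnion.2 ⟨⟨v.2, hvz⟩, (hσ.1 v hv).2⟩)
  let C' : ℕ → X → Set X := fun i => if i = n then fun z => closure (w z) else C i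
  have hC'n : C' n = fun z => closure (w z) := if_pos rfl
  have hC' : ∀ i < n, C' i = C i := fun i hi => if_neg hi.ne
  let t : (ℕ × X → ℝ) → ℕ × X → ℝ := fun a v => if v.1 < n then a v else 0
  have ht : Continuous t := by
    refine continuous_pi fun v => ?_
    by_cases hv : v.1 < n
    · simpa [t, hv] using continuous_apply _
    · simpa [t, hv] using continuous_const
  let G' : (ℕ × X → ℝ) → Y := fun a =>
    if hz : ∃ z, a (n, z) ≠ 0 then h hz.choose (t a) else G a
  have hG'neg : ∀ a : ℕ × X → ℝ, (∀ z, a (n, z) = 0) → G' a = G a := by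
    intro a ha
    refine dif_neg ?_
    push Not
    exact ha
  have key : ∀ x, ∀ σ ∈ chainsAt (n + 1) C' x,
      ContinuousOn G' (weightTop σ) ∧ MapsTo G' (weightTop σ) (Φ x) := by
    intro x σ hσ
    have hτ : σ.filter (fun v => v.1 < n) ∈ chainsAt n C x := by
      refine ⟨fun v hv => ?_, hσ.2.mono fun v hv => ?_⟩
      · have hv := Finset.mem_filter.1 hv
        have := (hσ.1 v hv.1).2
        rw [hC' _ hv.2] at this
        exact ⟨hv.2, this⟩
      · exact (Finset.mem_filter.1 hv).1
    by_cases hz : ∃ z, (n, z) ∈ σ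
    · obtain ⟨z, hz⟩ := hz
      have hxz : x ∈ O z := by
        have := (hσ.1 _ hz).2
        rw [hC'n] at this
        exact huO z (hwu z this)
      have hτz := hchain x z hxz _ hτ
      have htm : MapsTo t (weightCube σ) (weightCube (σ.filter fun v => v.1 < n)) := by
        intro a ha v
        by_cases hv : v.1 < n
        · simpa [t, hv] using ha v
        · simp [t, hv]
      have heq : EqOn G' (fun a => h z (t a)) (weightTop σ) := by
        intro a ha
        by_cases hza : ∃ z, a (n, z) ≠ 0
        · have : hza.choose = z := by
            have h1 : (n, hza.choose) ∈ σ := by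
              by_contra hcon
              exact hza.choose_spec ((ha.1 _).2 hcon)
            exact congrArg Prod.snd (hσ.2 h1 hz rfl)
          change (if hz : ∃ z, a (n, z) ≠ 0 then h hz.choose (t a) else G a) = _
          rw [dif_pos hza, this]
        · push Not at hza
          have hta : t a = a := by
            ext v
            by_cases hv : v.1 < n
            · simp [t, hv]
            · by_cases hvn : v.1 = n
              · have := hza v.2
                rw [← hvn] at this
                simpa [t, hv] using this.symm
              · have : a v = 0 := (ha.1 v).2 fun hvσ => by
                  have := (hσ.1 v hvσ).1
                  omega
                simp [t, hv, this]
          have hatop : a ∈ weightTop (σ.filter fun v => v.1 < n) :=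
            ⟨hta ▸ htm ha.1, ha.2⟩
          rw [hG'neg a hza]
          simp only [hta]
          exact (he z _ hτz hatop).symm
      have hmt : MapsTo (fun a => h z (t a)) (weightTop σ) (Φ x) := by
        intro a ha
        exact hxz.1 (mem_iUnion₂.2 ⟨_, hτz, _, htm ha.1, rfl⟩)
      refine ⟨ContinuousOn.congr ?_ heq, hmt.congr heq.symm⟩
      exact (hc z _ hτz).comp ht.continuousOn fun a ha => htm ha.1
    · push Not at hz
      have hτσ : σ.filter (fun v => v.1 < n) = σ := by
        refine Finset.filter_true_of_mem fun v hv => ?_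
        have h1 := (hσ.1 v hv).1
        rcases Nat.lt_succ_iff_lt_or_eq.1 h1 with h1 | h1
        · exact h1
        · exact absurd (h1 ▸ hv) (hz v.2)
      rw [hτσ] at hτ
      have heq : EqOn G' G (weightTop σ) := fun a ha =>
        hG'neg a fun z => (ha.1 _).2 (hz z)
      exact ⟨(hG.continuousOn x σ hτ).congr heq, (hG.mapsTo x σ hτ).congr heq.symm⟩
  refine ⟨C', G', ⟨?_, ?_, ?_, fun x σ hσ => (key x σ hσ).1, fun x σ hσ => (key x σ hσ).2⟩, hC',
    fun a ha => hG'neg a fun z => ?_⟩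
  · intro i hi
    rcases Nat.lt_succ_iff_lt_or_eq.1 hi with hi | rfl
    · rw [hC' i hi]
      exact hG.locallyFinite i hi
    · rw [hC'n]
      exact hulf.subset hwu
  · intro i hi
    rcases Nat.lt_succ_iff_lt_or_eq.1 hi with hi | rfl
    · rw [hC' i hi]
      exact hG.isClosed i hi
    · rw [hC'n]
      exact fun z => isClosed_closure
  · intro i hi
    rcases Nat.lt_succ_iff_lt_or_eq.1 hi with hi | rfl
    · rw [hC' i hi]
      exact hG.cover i hi
    · rw [hC'n]
      refine univ_subset_iff.1 (hwc ▸ iUnion_mono fun z => ?_)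
      exact (hwo z).subset_interior_iff.2 subset_closure
  · by_contra hcon
    exact lt_irrefl _ (ha _ hcon)

/-- Gluing the partial selections of all finite lengths. -/
theorem exists_partialSelection [T2Space X] [ParacompactSpace X] [Nonempty Y] {Φ : X → Set Y}
    (hne : ∀ x, (Φ x).Nonempty) (hllc : LowerLocallyConstant Φ)
    (hasph : ∀ x, ∀ k : ℕ, EmbedIn k (Φ x) (Φ x)) :
    ∃ (C : ℕ → X → Set X) (G : (ℕ × X → ℝ) → Y), (∀ i, ⋃ z, interior (C i z) = univ) ∧
      ∀ n x, ∀ σ ∈ chainsAt n C x,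
        ContinuousOn G (weightTop σ) ∧ MapsTo G (weightTop σ) (Φ x) := by
  classical
  obtain ⟨y₀⟩ := ‹Nonempty Y›
  have htop : ∀ (C : ℕ → X → Set X) (x : X), ∀ σ ∈ chainsAt 0 C x, weightTop σ = ∅ := by
    intro C x σ hσ
    refine eq_empty_of_forall_notMem fun a ha => ?_
    obtain ⟨ha, v, hv⟩ := ha
    have : a v = 0 := (ha v).2 fun hvσ => by simpa using (hσ.1 v hvσ).1
    linarith
  have h0 : IsPartialSelection Φ 0 (fun _ _ => univ) fun _ => y₀ := by
    refine ⟨by simp, by simp, by simp, fun _ _ _ => continuousOn_const, fun x σ hσ => ?_⟩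
    rw [htop _ x σ hσ]
    exact mapsTo_empty _ _
  let St : ℕ → Type _ := fun n =>
    {p : (ℕ → X → Set X) × ((ℕ × X → ℝ) → Y) // IsPartialSelection Φ n p.1 p.2}
  have hstep : ∀ n (p : St n), ∃ q : St (n + 1), (∀ i < n, q.1.1 i = p.1.1 i) ∧
      ∀ a : ℕ × X → ℝ, (∀ v, a v ≠ 0 → v.1 < n) → q.1.2 a = p.1.2 a := by
    intro n p
    obtain ⟨C', G', h1, h2⟩ := p.2.exists_succ hne hllc hasph
    exact ⟨⟨(C', G'), h1⟩, h2⟩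
  choose next hnextC hnextG using hstep
  let s : ∀ n, St n := fun n => Nat.rec (⟨(fun _ _ => univ, fun _ => y₀), h0⟩ : St 0) next n
  have hsC : ∀ n i, i < n → ∀ m, n ≤ m → (s m).1.1 i = (s n).1.1 i := by
    intro n i hi m hm
    induction m, hm using Nat.le_induction with
    | base => rfl
    | succ m hm ih => rw [← ih]; exact hnextC m (s m) i (hi.trans_le hm)
  have hsG : ∀ n (a : ℕ × X → ℝ), (∀ v, a v ≠ 0 → v.1 < n) → ∀ m, n ≤ m →
      (s m).1.2 a = (s n).1.2 a := by
    intro n a ha m hm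
    induction m, hm using Nat.le_induction with
    | base => rfl
    | succ m hm ih => rw [← ih]; exact hnextG m (s m) a fun v hv => (ha v hv).trans_le hm
  let C : ℕ → X → Set X := fun i => (s (i + 1)).1.1 i
  have hC : ∀ n, ∀ i < n, C i = (s n).1.1 i := fun n i hi =>
    (hsC (i + 1) i (Nat.lt_succ_self i) n hi).symm
  let G : (ℕ × X → ℝ) → Y := fun a =>
    if hN : ∃ n, ∀ v, a v ≠ 0 → v.1 < n then (s (Nat.find hN)).1.2 a else y₀
  have hGs : ∀ n (a : ℕ × X → ℝ), (∀ v, a v ≠ 0 → v.1 < n) → G a = (s n).1.2 a := by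
    intro n a ha
    have hN : ∃ n, ∀ v, a v ≠ 0 → v.1 < n := ⟨n, ha⟩
    rw [hsG (Nat.find hN) a (Nat.find_spec hN) n (Nat.find_min' hN ha)]
    exact dif_pos hN
  refine ⟨C, G, fun i => (s (i + 1)).2.cover i (Nat.lt_succ_self i), fun n x σ hσ => ?_⟩
  have hσ' : σ ∈ chainsAt n (s n).1.1 x := by
    refine ⟨fun v hv => ⟨(hσ.1 v hv).1, ?_⟩, hσ.2⟩
    rw [← hC n v.1 (hσ.1 v hv).1]
    exact (hσ.1 v hv).2
  have heq : EqOn G (s n).1.2 (weightTop σ) := by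
    intro a ha
    refine hGs n a fun v hv => ?_
    by_contra hcon
    exact hv ((ha.1 v).2 fun hvσ => hcon (hσ.1 v hvσ).1)
  exact ⟨((s n).2.continuousOn x σ hσ').congr heq, ((s n).2.mapsTo x σ hσ').congr heq.symm⟩

end PartialSelection

/-- On a paracompact Hausdorff C-space, every lower locally constant aspherical-valued
mapping into a Hausdorff space has a continuous selection. -/
theorem asphericalValued_selection_of_cSpace
    {X : Type*} [TopologicalSpace X] [T2Space X] [ParacompactSpace X]
    (hX : IsCSpace X)
    {Y : Type*} [TopologicalSpace Y] [T2Space Y] (Φ : X → Set Y)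
    (hne : ∀ x, (Φ x).Nonempty)
    (hllc : LowerLocallyConstant Φ)
    (hasph : ∀ x, ∀ k : ℕ, EmbedIn k (Φ x) (Φ x)) :
    ∃ f : X → Y, Continuous f ∧ ∀ x, f x ∈ Φ x := by
  classical
  rcases isEmpty_or_nonempty X with hXe | ⟨⟨x₀⟩⟩
  · exact ⟨fun x => isEmptyElim x, continuous_of_const fun x => isEmptyElim x,
      fun x => isEmptyElim x⟩
  have : Nonempty Y := ⟨(hne x₀).some⟩
  obtain ⟨C, G, hC, hG⟩ := exists_partialSelection hne hllc hasph
  obtain ⟨W, hWo, hWd, hWr, hWc⟩ := hX (fun n => range fun z => interior (C n z)) fun n =>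
    ⟨by rintro _ ⟨z, rfl⟩; exact isOpen_interior, by rw [sUnion_range]; exact hC n⟩
  have hWr' : ∀ n, ∀ v ∈ W n, ∃ z, v ⊆ C n z := by
    intro n v hv
    obtain ⟨_, ⟨z, rfl⟩, hz⟩ := hWr n v hv
    exact ⟨z, hz.trans interior_subset⟩
  have : Nonempty X := ⟨x₀⟩
  choose! c hc using hWr'
  let D : ℕ → X → Set X := fun n z => ⋃₀ {v | v ∈ W n ∧ c n v = z}
  have hDo : ∀ n z, IsOpen (D n z) := fun n z => isOpen_sUnion fun v hv => hWo n v hv.1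
  have hDC : ∀ n z, D n z ⊆ C n z := by
    rintro n z x ⟨v, ⟨hv, rfl⟩, hx⟩
    exact hc n v hv hx
  have hDd : ∀ n z z' x, x ∈ D n z → x ∈ D n z' → z = z' := by
    rintro n z z' x ⟨v, ⟨hv, rfl⟩, hx⟩ ⟨v', ⟨hv', rfl⟩, hx'⟩
    by_contra hcon
    exact disjoint_left.1 (hWd n hv hv' fun h => hcon (by rw [h])) hx hx'
  have hDW : ∀ n x, x ∈ ⋃₀ W n → ∃ z, x ∈ D n z := by
    rintro n x ⟨v, hv, hx⟩
    exact ⟨c n v, v, ⟨hv, rfl⟩, hx⟩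
  obtain ⟨β, hβ⟩ := BumpCovering.exists_isSubordinate isClosed_univ (fun n => ⋃₀ W n)
    (fun n => isOpen_sUnion (hWo n)) hWc.ge
  let b : X → ℕ × X → ℝ := fun x v => if x ∈ D v.1 v.2 then β v.1 x else 0
  have hloc : ∀ x, ContinuousAt b x ∧ ∃ n, ∃ σ : Finset (ℕ × X),
      ∀ᶠ y in 𝓝 x, σ ∈ chainsAt n C y ∧ b y ∈ weightTop σ := by
    intro x
    have hfin : {n | x ∈ tsupport (β n)}.Finite := β.locallyFinite_tsupport.point_finite x
    have hmem : ∀ n ∈ {n | x ∈ tsupport (β n)}, ∃ z, x ∈ D n z := fun n hn =>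
      hDW n x (hβ n hn)
    choose! ζ hζ using hmem
    let σ : Finset (ℕ × X) := hfin.toFinset.image fun n => (n, ζ n)
    have hσ : ∀ v : ℕ × X, v ∈ σ ↔ x ∈ tsupport (β v.1) ∧ ζ v.1 = v.2 := by
      rintro ⟨n, z⟩
      simp [σ]
    have hnear : ∀ᶠ y in 𝓝 x, (∀ v ∈ σ, y ∈ D v.1 v.2) ∧
        ∀ n, x ∉ tsupport (β n) → y ∉ tsupport (β n) := by
      refine Filter.Eventually.and ?_ ?_
      · rw [Filter.eventually_all_finset]
        intro v hv
        refine (hDo v.1 v.2).mem_nhds ?_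
        obtain ⟨h1, h2⟩ := (hσ v).1 hv
        exact h2 ▸ hζ v.1 h1
      · filter_upwards [β.locallyFinite_tsupport.iInter_compl_mem_nhds
          (fun n => isClosed_tsupport _) x] with y hy n hn
        simp only [mem_iInter] at hy
        exact hy n hn
    have hb : ∀ᶠ y in 𝓝 x, ∀ v, b y v = if v ∈ σ then β v.1 y else 0 := by
      filter_upwards [hnear] with y hy v
      by_cases hv : v ∈ σ
      · rw [if_pos hv]
        exact if_pos (hy.1 v hv)
      · rw [if_neg hv]
        by_cases hx : x ∈ tsupport (β v.1)
        · refine if_neg fun hyv => hv ((hσ v).2 ⟨hx, ?_⟩)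
          exact hDd v.1 _ _ y (hy.1 (v.1, ζ v.1) ((hσ _).2 ⟨hx, rfl⟩)) hyv
        · have : β v.1 y = 0 := image_eq_zero_of_notMem_tsupport (hy.2 _ hx)
          simp [b, this]
    refine ⟨?_, ?_⟩
    · refine continuousAt_pi.2 fun v => ?_
      have hev : (fun y => b y v) =ᶠ[𝓝 x] fun y => if v ∈ σ then β v.1 y else 0 := by
        filter_upwards [hb] with y hy using hy v
      refine ContinuousAt.congr ?_ hev.symm
      by_cases hv : v ∈ σ
      · simpa [hv] using (β v.1).continuous.continuousAt
      · simpa [hv] using continuousAt_const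
    · obtain ⟨n, hn⟩ := (σ.image Prod.fst).bddAbove
      refine ⟨n + 1, σ, ?_⟩
      filter_upwards [hb, hnear] with y hy hy'
      refine ⟨⟨fun v hv => ⟨?_, hDC _ _ (hy'.1 v hv)⟩, ?_⟩, fun v => ⟨?_, fun hv => ?_⟩, ?_⟩
      · exact Nat.lt_succ_of_le (hn (Finset.mem_coe.2 (Finset.mem_image_of_mem _ hv)))
      · intro v hv v' hv' hvv
        refine Prod.ext hvv ?_
        rw [← ((hσ v).1 hv).2, ← ((hσ v').1 hv').2, hvv]
      · rw [hy v]
        split_ifs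
        · exact ⟨β.nonneg _ _, β.le_one _ _⟩
        · simp
      · rw [hy v, if_neg hv]
      · obtain ⟨m, hm⟩ := β.eventuallyEq_one' y (mem_univ y)
        have hm1 : β m y = 1 := hm.self_of_nhds
        have hmx : x ∈ tsupport (β m) := by
          by_contra hcon
          have := image_eq_zero_of_notMem_tsupport (hy'.2 m hcon)
          linarith
        refine ⟨(m, ζ m), ?_⟩
        rw [hy, if_pos ((hσ _).2 ⟨hmx, rfl⟩)]
        exact hm1
  refine ⟨fun x => G (b x), continuous_iff_continuousAt.2 fun x => ?_, fun x => ?_⟩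
  · obtain ⟨hbc, n, σ, hσ⟩ := hloc x
    obtain ⟨hσx, hbx⟩ := hσ.self_of_nhds
    exact ((hG n x σ hσx).1 _ hbx).tendsto.comp
      (tendsto_nhdsWithin_iff.2 ⟨hbc, hσ.mono fun y hy => hy.2⟩)
  · obtain ⟨-, n, σ, hσ⟩ := hloc x
    obtain ⟨hσx, hbx⟩ := hσ.self_of_nhds
    exact (hG n x σ hσx).2 hbx
end
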